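/- Let G be a minimal counterexample. If v is a 3-vertex in F ∪ U with no neighbors in I, then v is not incident to a 2-thread in G. -/

import Mathlib

open SimpleGraph

noncomputable def edgeCount {V : Type*} (G : SimpleGraph V) : ℕ := Nat.card G.edgeSet

noncomputable def deg {V : Type*} (G : SimpleGraph V) (v : V) : ℕ := Nat.card (G.neighborSet v)

def TwoIndependent {V : Type*} (G : SimpleGraph V) (S : Set V) : Prop :=
  ∀ u ∈ S, ∀ v ∈ S, u ≠ v → ¬ G.Adj u v ∧ ∀ w, ¬ (G.Adj u w ∧ G.Adj w v)

def IsIFPartition {V : Type*} (G : SimpleGraph V) (A B : Set V) : Prop :=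
  A ∪ B = Set.univ ∧ Disjoint A B ∧ TwoIndependent G A ∧ (G.induce B).IsAcyclic

def IsAssignment {V : Type*} (I F U : Set V) : Prop :=
  I ∪ F ∪ U = Set.univ ∧ Disjoint I F ∧ Disjoint I U ∧ Disjoint F U

noncomputable def rho {V : Type*} (G : SimpleGraph V) (I F U : Set V) (H : G.Subgraph) : ℤ :=
  (H.verts ∩ I).ncard + 4 * (H.verts ∩ F).ncard + 5 * (H.verts ∩ U).ncard
    - 4 * Nat.card H.edgeSet

noncomputable def rhoSet {V : Type*} (G : SimpleGraph V) (I F U : Set V) (S : Set V) : ℤ :=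
  (S ∩ I).ncard + 4 * (S ∩ F).ncard + 5 * (S ∩ U).ncard - 4 * edgeCount (G.induce S)

def IsCounterexample {V : Type*} [Fintype V] (G : SimpleGraph V) (I F U : Set V) : Prop :=
  IsAssignment I F U ∧
  (∀ H : G.Subgraph, H.verts.Nonempty → 0 < rho G I F U H) ∧
  ¬ ∃ A B : Set V, IsIFPartition G A B ∧ I ⊆ A ∧ F ⊆ B

def IsMinCounterexample {V : Type*} [Fintype V] (G : SimpleGraph V) (I F U : Set V) : Prop :=
  IsCounterexample G I F U ∧
  ∀ (n : ℕ) (G' : SimpleGraph (Fin n)) (I' F' U' : Set (Fin n)),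
    IsCounterexample G' I' F' U' →
    Fintype.card V + edgeCount G ≤ n + edgeCount G'

def IsThread {V : Type*} (G : SimpleGraph V) (I F U : Set V) (p : List V) : Prop :=
  p ≠ [] ∧ p.Nodup ∧ p.Chain' G.Adj ∧ (∀ v ∈ p, v ∈ U ∧ deg G v = 2) ∧
  (∀ w, w ∉ p → (∃ a ∈ p, G.Adj a w) → 3 ≤ deg G w ∨ w ∈ I ∪ F)

def BordersThread {V : Type*} (G : SimpleGraph V) (p : List V) (w : V) : Prop :=
  w ∉ p ∧ ∃ a ∈ p, G.Adj a w

def IsStarForest {V : Type*} (H : SimpleGraph V) : Prop :=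
  H.IsAcyclic ∧ ∀ a b c d : V, H.Adj a b → H.Adj b c → H.Adj c d → a = c ∨ b = d

def IsStarColoring {V : Type*} {k : ℕ} (G : SimpleGraph V) (c : V → Fin k) : Prop :=
  (∀ u v, G.Adj u v → c u ≠ c v) ∧
  ∀ i j : Fin k, IsStarForest (G.induce {v | c v = i ∨ c v = j})

def StarColorable {V : Type*} (G : SimpleGraph V) (k : ℕ) : Prop :=
  ∃ c : V → Fin k, IsStarColoring G c

def MadLt {V : Type*} (G : SimpleGraph V) (q : ℚ) : Prop :=
  ∀ H : G.Subgraph, H.verts.Nonempty →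
    (2 * (Nat.card H.edgeSet : ℚ)) / (H.verts.ncard : ℚ) < q


section Helpers
open Classical

/-- Every nonempty subset has a vertex with at most one neighbour inside. -/
def Forest' {X : Type*} (G : SimpleGraph X) (B : Finset X) : Prop :=
  ∀ C ⊆ B, C.Nonempty → ∃ c ∈ C, ∀ a ∈ C, ∀ b ∈ C, G.Adj c a → G.Adj c b → a = b

lemma exists_leaf {X : Type*} [Finite X] [Nonempty X] (G : SimpleGraph X) (h : G.IsAcyclic) :
    ∃ c, ∀ a b, G.Adj c a → G.Adj c b → a = b := by
  have := Fintype.ofFinite X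
  let s : Set ℕ := {n | ∃ (u v : X) (p : G.Walk u v), p.IsPath ∧ p.length = n}
  have hne : s.Nonempty := by
    obtain ⟨x⟩ := ‹Nonempty X›
    exact ⟨0, x, x, Walk.nil, by simp, rfl⟩
  have hb : BddAbove s := by
    refine ⟨Fintype.card X, ?_⟩
    rintro n ⟨u, v, p, hp, rfl⟩
    exact hp.length_lt.le
  obtain ⟨u, v, p, hp, hl⟩ := Nat.sSup_mem hne hb
  have key : ∀ a, G.Adj v a → a = p.penultimate := by
    intro a ha
    by_cases hm : a ∈ p.support
    · exact h.eq_penultimate_of_adj_end hp ha hm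
    · exfalso
      have h2 : (p.concat ha).length ∈ s := ⟨u, a, p.concat ha, hp.concat hm ha, rfl⟩
      have h3 := le_csSup hb h2
      rw [Walk.length_concat, hl] at h3
      omega
  exact ⟨v, fun a b ha hb => (key a ha).trans (key b hb).symm⟩

lemma forest_of_acyclic {X : Type*} (G : SimpleGraph X) (B : Finset X) (S : Set X)
    (hBS : ∀ a ∈ B, a ∈ S) (h : (G.induce S).IsAcyclic) : Forest' G B := by
  intro C hC hne
  have hCS : (C : Set X) ⊆ S := fun a ha => hBS a (hC ha)
  have h2 : (G.induce (C : Set X)).IsAcyclic :=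
    h.comap (SimpleGraph.induceHomOfLE G hCS).toHom
      (SimpleGraph.induceHomOfLE G hCS).injective
  have : Nonempty (C : Set X) := by
    obtain ⟨x, hx⟩ := hne
    exact ⟨⟨x, hx⟩⟩
  have : Finite (C : Set X) := C.finite_toSet
  obtain ⟨c, hc⟩ := exists_leaf _ h2
  refine ⟨c.1, c.2, fun a ha b hb hca hcb => ?_⟩
  have := hc ⟨a, ha⟩ ⟨b, hb⟩ hca hcb
  exact congrArg Subtype.val this

lemma acyclic_of_forest {X : Type*} (G : SimpleGraph X) (B : Finset X) (S : Set X)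
    (hBS : ∀ a ∈ S, a ∈ B) (h : Forest' G B) : (G.induce S).IsAcyclic := by
  intro v p hp
  let C : Finset X := p.support.toFinset.image Subtype.val
  have hC : C ⊆ B := by
    intro a ha
    simp only [C, Finset.mem_image] at ha
    obtain ⟨b, _, rfl⟩ := ha
    exact hBS _ b.2
  obtain ⟨c, hc, hcl⟩ := h C hC ⟨v.1, Finset.mem_image.2 ⟨v, by simp, rfl⟩⟩
  simp only [C, Finset.mem_image, List.mem_toFinset] at hc
  obtain ⟨c, hcp, rfl⟩ := hc
  have h2 := hp.ncard_neighborSet_toSubgraph_eq_two hcp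
  obtain ⟨a, b, hab, hs⟩ := Set.ncard_eq_two.1 h2
  have ha : a ∈ p.toSubgraph.neighborSet c := by rw [hs]; simp
  have hb : b ∈ p.toSubgraph.neighborSet c := by rw [hs]; simp
  apply hab
  have hma : a ∈ p.support := by
    rw [← Walk.mem_verts_toSubgraph]; exact ha.snd_mem
  have hmb : b ∈ p.support := by
    rw [← Walk.mem_verts_toSubgraph]; exact hb.snd_mem
  exact Subtype.ext (hcl a.1 (Finset.mem_image.2 ⟨a, by simpa using hma, rfl⟩) b.1
    (Finset.mem_image.2 ⟨b, by simpa using hmb, rfl⟩) ha.adj_sub hb.adj_sub)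

lemma Forest'.strong {X : Type*} {G : SimpleGraph X} {B : Finset X} (h : Forest' G B) :
    ∀ (n : ℕ) (C : Finset X), C.card = n → C ⊆ B → ∀ c₀ ∈ C, (∃ c ∈ C, c ≠ c₀) →
      ∃ c ∈ C, c ≠ c₀ ∧ ∀ a ∈ C, ∀ b ∈ C, G.Adj c a → G.Adj c b → a = b := by
  intro n
  induction n with
  | zero => intro C hn _ c₀ hc₀; simp at hn; simp [hn] at hc₀
  | succ n ih =>
    intro C hn hC c₀ hc₀ hne
    by_contra hcon
    push Not at hcon
    -- c₀ is the only leaf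
    have hleaf : ∀ a ∈ C, ∀ b ∈ C, G.Adj c₀ a → G.Adj c₀ b → a = b := by
      obtain ⟨c, hc, hl⟩ := h C hC ⟨c₀, hc₀⟩
      by_cases hcc : c = c₀
      · subst hcc; exact hl
      · obtain ⟨a, ha, b, hb, h1, h2, h3⟩ := hcon c hc hcc
        exact absurd (hl a ha b hb h1 h2) h3
    have hcard : (C.erase c₀).card = n := by rw [Finset.card_erase_of_mem hc₀, hn]; rfl
    have hsub : C.erase c₀ ⊆ B := (Finset.erase_subset _ _).trans hC
    -- find a leaf of C.erase c₀ not adjacent to c₀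
    have key : ∀ c ∈ C.erase c₀, ¬ G.Adj c c₀ →
        ¬ ∀ a ∈ C.erase c₀, ∀ b ∈ C.erase c₀, G.Adj c a → G.Adj c b → a = b := by
      intro c hc hnadj hl
      obtain ⟨a, ha, b, hb, h1, h2, h3⟩ := hcon c (Finset.mem_of_mem_erase hc) (Finset.ne_of_mem_erase hc)
      refine h3 (hl a (Finset.mem_erase.2 ⟨?_, ha⟩) b (Finset.mem_erase.2 ⟨?_, hb⟩) h1 h2)
      · rintro rfl; exact hnadj h1
      · rintro rfl; exact hnadj h2
    by_cases hn1 : ∃ c₁ ∈ C.erase c₀, G.Adj c₀ c₁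
    · obtain ⟨c₁, hc₁, hadj⟩ := hn1
      by_cases hmore : ∃ c ∈ C.erase c₀, c ≠ c₁
      · obtain ⟨c, hc, hcne, hl⟩ := ih _ hcard hsub c₁ hc₁ hmore
        refine key c hc ?_ hl
        intro hca
        exact hcne (hleaf c (Finset.mem_of_mem_erase hc) c₁ (Finset.mem_of_mem_erase hc₁) hca.symm hadj)
      · push Not at hmore
        obtain ⟨a, ha, b, hb, h1, h2, h3⟩ := hcon c₁ (Finset.mem_of_mem_erase hc₁) (Finset.ne_of_mem_erase hc₁)
        have aux : ∀ z ∈ C, G.Adj c₁ z → z = c₀ := by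
          intro z hz hz2
          by_contra hzc
          have := hmore z (Finset.mem_erase.2 ⟨hzc, hz⟩)
          subst this
          exact G.loopless.irrefl _ hz2
        exact h3 ((aux a ha h1).trans (aux b hb h2).symm)
    · push Not at hn1
      have hne2 : (C.erase c₀).Nonempty := by
        obtain ⟨c, hc, hcc⟩ := hne
        exact ⟨c, Finset.mem_erase.2 ⟨hcc, hc⟩⟩
      obtain ⟨c, hc, hl⟩ := h _ hsub hne2
      exact key c hc (fun hca => hn1 c hc hca.symm) hl

/-- number of ordered adjacent pairs in `K × L` -/
noncomputable def eb {X : Type*} (G : SimpleGraph X) (K L : Finset X) : ℤ :=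
  ∑ a ∈ K, ∑ b ∈ L, if G.Adj a b then 1 else 0

/-- the potential of a vertex set -/
noncomputable def pot {X : Type*} (G : SimpleGraph X) (w : X → ℤ) (K : Finset X) : ℤ :=
  ∑ a ∈ K, w a - 2 * eb G K K

lemma eb_comm {X : Type*} (G : SimpleGraph X) (K L : Finset X) : eb G K L = eb G L K := by
  unfold eb
  rw [Finset.sum_comm]
  simp only [G.adj_comm]

lemma eb_nonneg {X : Type*} (G : SimpleGraph X) (K L : Finset X) : 0 ≤ eb G K L := by
  unfold eb
  exact Finset.sum_nonneg fun a _ => Finset.sum_nonneg fun b _ => by split_ifs <;> norm_num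

lemma eb_union_left {X : Type*} (G : SimpleGraph X) {K L : Finset X} (h : Disjoint K L)
    (M : Finset X) : eb G (K ∪ L) M = eb G K M + eb G L M := by
  unfold eb; rw [Finset.sum_union h]

lemma eb_union_right {X : Type*} (G : SimpleGraph X) {K L : Finset X} (h : Disjoint K L)
    (M : Finset X) : eb G M (K ∪ L) = eb G M K + eb G M L := by
  rw [eb_comm, eb_union_left G h, eb_comm G K, eb_comm G L]

lemma eb_single {X : Type*} (G : SimpleGraph X) (a b : X) :
    eb G {a} {b} = if G.Adj a b then 1 else 0 := by
  simp only [eb, Finset.sum_singleton]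

lemma eb_empty_left {X : Type*} (G : SimpleGraph X) (M : Finset X) : eb G ∅ M = 0 := by
  simp [eb]

lemma eb_empty_right {X : Type*} (G : SimpleGraph X) (M : Finset X) : eb G M ∅ = 0 := by
  simp [eb]

lemma eb_mono_left {X : Type*} (G : SimpleGraph X) {K L : Finset X} (h : K ⊆ L) (M : Finset X) :
    eb G K M ≤ eb G L M := by
  unfold eb
  exact Finset.sum_le_sum_of_subset_of_nonneg h fun a _ _ =>
    Finset.sum_nonneg fun b _ => by split_ifs <;> norm_num

lemma eb_mono {X : Type*} (G : SimpleGraph X) {K L M N : Finset X} (h : K ⊆ L) (h' : M ⊆ N) :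
    eb G K M ≤ eb G L N := by
  refine (eb_mono_left G h M).trans ?_
  rw [eb_comm G L, eb_comm G L]
  exact eb_mono_left G h' L

lemma eb_pos {X : Type*} (G : SimpleGraph X) {K L : Finset X} {a b : X} (ha : a ∈ K) (hb : b ∈ L)
    (h : G.Adj a b) : 1 ≤ eb G K L := by
  have := eb_mono G (Finset.singleton_subset_iff.2 ha) (Finset.singleton_subset_iff.2 hb)
  rw [eb_single, if_pos h] at this
  exact this

lemma eb_pos_two {X : Type*} (G : SimpleGraph X) {L : Finset X} {a b c : X}
    (hb : b ∈ L) (hc : c ∈ L) (hbc : b ≠ c)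
    (h : G.Adj a b) (h' : G.Adj a c) : 2 ≤ eb G {a} L := by
  have h1 : ({b} ∪ {c} : Finset X) ⊆ L := by
    intro z hz
    simp at hz
    rcases hz with rfl | rfl <;> assumption
  have := eb_mono G (Finset.Subset.refl {a}) h1
  rw [eb_union_right G (by simpa using hbc), eb_single, eb_single, if_pos h, if_pos h'] at this
  linarith

lemma eb_le_card {X : Type*} (G : SimpleGraph X) (K : Finset X) :
    eb G K K ≤ K.card * (K.card - 1) := by
  unfold eb
  have : ∀ a ∈ K, (∑ b ∈ K, if G.Adj a b then (1:ℤ) else 0) ≤ K.card - 1 := by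
    intro a ha
    rw [← Finset.add_sum_erase K _ ha]
    simp only [SimpleGraph.irrefl, if_false, zero_add]
    have h2 : (∑ b ∈ K.erase a, if G.Adj a b then (1:ℤ) else 0) ≤ ∑ b ∈ K.erase a, 1 :=
      Finset.sum_le_sum fun b _ => by split_ifs <;> norm_num
    refine h2.trans ?_
    have h3 := Finset.card_erase_add_one ha
    simp only [Finset.sum_const, nsmul_eq_mul, mul_one]
    omega
  refine (Finset.sum_le_sum this).trans ?_
  rw [Finset.sum_const, nsmul_eq_mul]

lemma pot_union {X : Type*} (G : SimpleGraph X) (w : X → ℤ) {K L : Finset X} (h : Disjoint K L) :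
    pot G w (K ∪ L) = pot G w K + pot G w L - 4 * eb G K L := by
  unfold pot
  rw [Finset.sum_union h, eb_union_left G h, eb_union_right G h, eb_union_right G h, eb_comm G L K]
  ring

lemma pot_single {X : Type*} (G : SimpleGraph X) (w : X → ℤ) (a : X) : pot G w {a} = w a := by
  simp [pot, eb_single]

lemma pot_insert {X : Type*} (G : SimpleGraph X) (w : X → ℤ) {K : Finset X} {a : X} (h : a ∉ K) :
    pot G w (insert a K) = pot G w K + w a - 4 * eb G {a} K := by
  rw [Finset.insert_eq, pot_union G w (by simpa using h), pot_single]
  ring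

/-- a good set: `A` is the 2-independent part of a partition of `G[R]`. -/
structure Good {X : Type*} (G : SimpleGraph X) (w : X → ℤ) (R A : Finset X) : Prop where
  sub : A ⊆ R
  one : ∀ a ∈ R, w a = 1 → a ∈ A
  four : ∀ a ∈ R, w a = 4 → a ∉ A
  ind : ∀ a ∈ A, ∀ b ∈ A, a ≠ b → ¬ G.Adj a b ∧ ∀ m ∈ R, ¬ (G.Adj a m ∧ G.Adj m b)
  forest : Forest' G (R \ A)

lemma Good.mono {X : Type*} {G : SimpleGraph X} {w w' : X → ℤ} {R A : Finset X}
    (h : Good G w' R A) (h1 : ∀ a ∈ R, w a = 1 → w' a = 1) (h4 : ∀ a ∈ R, w a = 4 → w' a = 4) :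
    Good G w R A :=
  ⟨h.sub, fun a ha hw => h.one a ha (h1 a ha hw), fun a ha hw => h.four a ha (h4 a ha hw),
    h.ind, h.forest⟩

/-- every small enough graph of positive potential is colourable -/
def SmallOK (N : ℤ) : Prop :=
  ∀ (n : ℕ) (G : SimpleGraph (Fin n)) (w : Fin n → ℤ), (∀ a, w a = 1 ∨ w a = 4 ∨ w a = 5) →
    (∀ K : Finset (Fin n), K.Nonempty → 0 < pot G w K) →
    2 * (n : ℤ) + eb G Finset.univ Finset.univ < N → ∃ A, Good G w Finset.univ A

lemma SmallOK.apply {N : ℤ} (hN : SmallOK N) {X : Type*} (G : SimpleGraph X) (w : X → ℤ)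
    (R : Finset X) (hw : ∀ a ∈ R, w a = 1 ∨ w a = 4 ∨ w a = 5)
    (hpos : ∀ K ⊆ R, K.Nonempty → 0 < pot G w K)
    (hsize : 2 * (R.card : ℤ) + eb G R R < N) : ∃ A, Good G w R A := by
  let e : Fin R.card ↪ X := R.equivFin.symm.toEmbedding.trans (Function.Embedding.subtype _)
  have heR : ∀ i, e i ∈ R := fun i => (R.equivFin.symm i).2
  have hsurj : ∀ a ∈ R, ∃ i, e i = a := fun a ha => ⟨R.equivFin ⟨a, ha⟩, by simp [e]⟩
  have huniv : Finset.univ.map e = R := by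
    ext a
    simp only [Finset.mem_map, Finset.mem_univ, true_and]
    exact ⟨fun ⟨i, hi⟩ => hi ▸ heR i, hsurj a⟩
  have hmapR : ∀ K : Finset (Fin R.card), K.map e ⊆ R := by
    intro K a ha
    obtain ⟨i, _, rfl⟩ := Finset.mem_map.1 ha
    exact heR i
  have heb : ∀ K L : Finset (Fin R.card), eb (G.comap e) K L = eb G (K.map e) (L.map e) := by
    intro K L
    simp only [eb, Finset.sum_map, SimpleGraph.comap_adj]
  have hpot : ∀ K : Finset (Fin R.card), pot (G.comap e) (w ∘ e) K = pot G w (K.map e) := by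
    intro K
    simp [pot, heb, Finset.sum_map]
  obtain ⟨A, hA⟩ := hN R.card (G.comap e) (w ∘ e) (fun i => hw _ (heR i))
    (fun K hK => by rw [hpot]; exact hpos _ (hmapR K) (hK.map))
    (by rw [heb, huniv]; exact hsize)
  refine ⟨A.map e, hmapR A, ?_, ?_, ?_, ?_⟩
  · intro a ha hwa
    obtain ⟨i, rfl⟩ := hsurj a ha
    exact Finset.mem_map_of_mem _ (hA.one i (Finset.mem_univ _) hwa)
  · intro a ha hwa
    obtain ⟨i, rfl⟩ := hsurj a ha
    rw [Finset.mem_map']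
    exact hA.four i (Finset.mem_univ _) hwa
  · intro a ha b hb hab
    obtain ⟨i, hi, rfl⟩ := Finset.mem_map.1 ha
    obtain ⟨j, hj, rfl⟩ := Finset.mem_map.1 hb
    obtain ⟨h1, h2⟩ := hA.ind i hi j hj (fun h => hab (h ▸ rfl))
    refine ⟨h1, fun m hm => ?_⟩
    obtain ⟨k, rfl⟩ := hsurj m hm
    exact h2 k (Finset.mem_univ _)
  · intro C hC hne
    have hCi : ∀ c ∈ C, ∃ i, e i = c := fun c hc => hsurj c (Finset.mem_sdiff.1 (hC hc)).1
    let C' : Finset (Fin R.card) := Finset.univ.filter (fun i => e i ∈ C)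
    obtain ⟨c, hc, hl⟩ := hA.forest C' (by
        intro i hi
        have hi' : e i ∈ C := by simpa [C'] using hi
        have := (Finset.mem_sdiff.1 (hC hi')).2
        rw [Finset.mem_map'] at this
        simp [this]) (by
        obtain ⟨c, hc⟩ := hne
        obtain ⟨i, rfl⟩ := hCi c hc
        exact ⟨i, by simpa [C'] using hc⟩)
    refine ⟨e c, by simpa [C'] using hc, fun a ha b hb hca hcb => ?_⟩
    obtain ⟨i, rfl⟩ := hCi a ha
    obtain ⟨j, rfl⟩ := hCi b hb
    exact congrArg e (hl i (by simpa [C'] using ha) j (by simpa [C'] using hb) hca hcb)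

lemma eb_univ_spanning {X : Type*} [Fintype X] (G : SimpleGraph X) :
    eb G Finset.univ Finset.univ = 2 * (Nat.card G.edgeSet : ℤ) := by
  have h := G.sum_degrees_eq_twice_card_edges
  have h1 : (Nat.card G.edgeSet) = G.edgeFinset.card := by
    rw [Nat.card_eq_fintype_card, SimpleGraph.edgeFinset_card]
  have h2 : eb G Finset.univ Finset.univ = ((∑ v, G.degree v : ℕ) : ℤ) := by
    unfold eb
    push_cast
    refine Finset.sum_congr rfl fun a _ => ?_
    rw [← SimpleGraph.card_neighborFinset_eq_degree, SimpleGraph.neighborFinset_eq_filter]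
    simp
  rw [h2, h, h1]
  push_cast
  ring

/-- the weight function of an assignment -/
noncomputable def wt {X : Type*} (I F : Set X) (a : X) : ℤ :=
  if a ∈ I then 1 else if a ∈ F then 4 else 5

lemma wt_cases {X : Type*} (I F : Set X) (a : X) : wt I F a = 1 ∨ wt I F a = 4 ∨ wt I F a = 5 := by
  unfold wt; split_ifs <;> simp

lemma sum_wt {X : Type*} [Fintype X] {I F U : Set X} (h : IsAssignment I F U) (S : Set X) :
    ((S ∩ I).ncard : ℤ) + 4 * (S ∩ F).ncard + 5 * (S ∩ U).ncard = ∑ a ∈ S.toFinset, wt I F a := by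
  obtain ⟨h1, h2, h3, h4⟩ := h
  have key : ∀ T : Set X, ((S ∩ T).ncard : ℤ) = ∑ a ∈ S.toFinset, if a ∈ T then 1 else 0 := by
    intro T
    rw [Set.ncard_eq_toFinset_card']
    rw [Finset.sum_ite, Finset.sum_const_zero, add_zero, Finset.sum_const, nsmul_eq_mul, mul_one]
    congr 2
    ext a
    simp
  rw [key, key, key, Finset.mul_sum, Finset.mul_sum, ← Finset.sum_add_distrib,
    ← Finset.sum_add_distrib]
  refine Finset.sum_congr rfl fun a _ => ?_
  have ha : a ∈ I ∪ F ∪ U := by rw [h1]; trivial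
  have d1 : a ∈ I → a ∉ F := fun x => Set.disjoint_left.1 h2 x
  have d2 : a ∈ I → a ∉ U := fun x => Set.disjoint_left.1 h3 x
  have d3 : a ∈ F → a ∉ U := fun x => Set.disjoint_left.1 h4 x
  unfold wt
  rcases ha with (ha | ha) | ha
  · simp [ha, d1 ha, d2 ha]
  · have : a ∉ I := fun h => d1 h ha
    simp [ha, this, d3 ha]
  · have e1 : a ∉ I := fun h => d2 h ha
    have e2 : a ∉ F := fun h => d3 h ha
    simp [ha, e1, e2]

lemma eb_verts {X : Type*} [Fintype X] (G : SimpleGraph X) (H : G.Subgraph) :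
    2 * (Nat.card H.edgeSet : ℤ) ≤ eb G H.verts.toFinset H.verts.toFinset := by
  have h := eb_univ_spanning H.spanningCoe
  rw [Subgraph.edgeSet_spanningCoe] at h
  rw [← h]
  unfold eb
  rw [← Finset.sum_subset (Finset.subset_univ H.verts.toFinset)]
  · refine Finset.sum_le_sum fun a _ => ?_
    rw [← Finset.sum_subset (Finset.subset_univ H.verts.toFinset)]
    · refine Finset.sum_le_sum fun b _ => ?_
      by_cases hab : H.Adj a b
      · simp [hab, hab.adj_sub]
      · simp only [Subgraph.spanningCoe_adj, hab, if_false]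
        split_ifs <;> norm_num
    · intro b _ hb
      have : ¬ H.Adj a b := fun h => hb (by simpa using h.snd_mem)
      simp [this]
  · intro a _ ha
    refine Finset.sum_eq_zero fun b _ => ?_
    have : ¬ H.Adj a b := fun h => ha (by simpa using h.fst_mem)
    simp [this]

lemma rho_ge {X : Type*} [Fintype X] {G : SimpleGraph X} {I F U : Set X} (h : IsAssignment I F U)
    (H : G.Subgraph) : pot G (wt I F) H.verts.toFinset ≤ rho G I F U H := by
  unfold rho pot
  rw [sum_wt h]
  have := eb_verts G H
  linarith

lemma rho_induce {X : Type*} [Fintype X] {G : SimpleGraph X} {I F U : Set X}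
    (h : IsAssignment I F U) (K : Finset X) :
    rho G I F U ((⊤ : G.Subgraph).induce K) = pot G (wt I F) K := by
  unfold rho pot
  rw [sum_wt h]
  have h2 := eb_univ_spanning ((⊤ : G.Subgraph).induce (K : Set X)).spanningCoe
  rw [Subgraph.edgeSet_spanningCoe] at h2
  have h3 : eb ((⊤ : G.Subgraph).induce (K : Set X)).spanningCoe Finset.univ Finset.univ = eb G K K := by
    unfold eb
    rw [← Finset.sum_subset (Finset.subset_univ K)]
    · refine Finset.sum_congr rfl fun a ha => ?_
      rw [← Finset.sum_subset (Finset.subset_univ K)]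
      · refine Finset.sum_congr rfl fun b hb => ?_
        simp [ha, hb]
      · intro b _ hb
        simp [hb]
    · intro a _ ha
      simp [ha]
  have h4 : ((⊤ : G.Subgraph).induce (K : Set X)).verts.toFinset = K := by
    ext a; simp
  rw [h4]
  linarith

lemma good_univ_iff {X : Type*} [Fintype X] {G : SimpleGraph X} {I F U : Set X}
    (h : IsAssignment I F U) :
    (∃ A B : Set X, IsIFPartition G A B ∧ I ⊆ A ∧ F ⊆ B) ↔
      ∃ A, Good G (wt I F) Finset.univ A := by
  have hIF : ∀ a, a ∈ F → a ∉ I := fun a ha hi => Set.disjoint_left.1 h.2.1 hi ha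
  constructor
  · rintro ⟨A, B, ⟨hAB, hd, hT, hac⟩, hI, hF⟩
    refine ⟨A.toFinset, Finset.subset_univ _, ?_, ?_, ?_, ?_⟩
    · intro a _ ha
      have : a ∈ I := by
        unfold wt at ha
        split_ifs at ha <;> simp_all
      simpa using hI this
    · intro a _ ha
      have : a ∈ F := by
        unfold wt at ha
        split_ifs at ha <;> simp_all
      have := hF this
      simpa using fun h => Set.disjoint_left.1 hd h this
    · intro a ha b hb hab
      obtain ⟨h1, h2⟩ := hT a (by simpa using ha) b (by simpa using hb) hab
      exact ⟨h1, fun m _ => h2 m⟩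
    · refine forest_of_acyclic G _ B ?_ hac
      intro a ha
      have h1 : a ∉ A := by simpa using ha
      have h2 : a ∈ A ∪ B := by rw [hAB]; trivial
      exact h2.resolve_left h1
  · rintro ⟨A, hA⟩
    refine ⟨A, ((A : Set X))ᶜ, ⟨by simp, disjoint_compl_right, ?_, ?_⟩, ?_, ?_⟩
    · intro a ha b hb hab
      obtain ⟨h1, h2⟩ := hA.ind a ha b hb hab
      exact ⟨h1, fun m => h2 m (Finset.mem_univ _)⟩
    · refine acyclic_of_forest G _ _ ?_ hA.forest
      intro a ha
      simpa using ha
    · intro a ha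
      exact hA.one a (Finset.mem_univ _) (by simp [wt, ha])
    · intro a ha
      exact hA.four a (Finset.mem_univ _) (by simp [wt, ha, hIF a ha])

lemma smallOK_of_min {X : Type*} [Fintype X] {G : SimpleGraph X} {I F U : Set X}
    (h : IsMinCounterexample G I F U) :
    SmallOK (2 * (Fintype.card X : ℤ) + eb G Finset.univ Finset.univ) := by
  intro n G' w hw hpos hsize
  by_contra hcon
  have hass : IsAssignment {a | w a = 1} {a | w a = 4} {a | w a = 5} := by
    refine ⟨?_, ?_, ?_, ?_⟩
    · ext a
      simpa [or_assoc] using hw a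
    all_goals
      rw [Set.disjoint_left]
      intro a h1 h2
      simp only [Set.mem_ofPred_eq] at h1 h2
      omega
  have hwt : wt {a | w a = 1} {a | w a = 4} = w := by
    ext a
    unfold wt
    rcases hw a with h | h | h <;> simp [h]
  have := h.2 n G' {a | w a = 1} {a | w a = 4} {a | w a = 5} ⟨hass, ?_, ?_⟩
  · rw [eb_univ_spanning, eb_univ_spanning] at hsize
    unfold edgeCount at this
    omega
  · intro H hH
    refine lt_of_lt_of_le ?_ (rho_ge hass H)
    rw [hwt]
    exact hpos _ (by simpa using hH)
  · rw [good_univ_iff hass, hwt]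
    exact hcon

/-- The finset-version of a minimal counterexample. -/
structure MinC {X : Type*} [Fintype X] (G : SimpleGraph X) (w : X → ℤ) : Prop where
  cases : ∀ a, w a = 1 ∨ w a = 4 ∨ w a = 5
  pos : ∀ K : Finset X, K.Nonempty → 0 < pot G w K
  no : ¬ ∃ A, Good G w Finset.univ A
  small : SmallOK (2 * (Fintype.card X : ℤ) + eb G Finset.univ Finset.univ)

lemma minC_of_min {X : Type*} [Fintype X] {G : SimpleGraph X} {I F U : Set X}
    (h : IsMinCounterexample G I F U) : MinC G (wt I F) := by
  obtain ⟨hass, hpos, hno⟩ := h.1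
  refine ⟨wt_cases I F, ?_, ?_, smallOK_of_min h⟩
  · intro K hK
    rw [← rho_induce hass]
    exact hpos _ (by simpa using hK)
  · rwa [← good_univ_iff hass]

/-- glueing a gadget on `Fin k` in place of `S` -/
def glueG {X : Type*} {k : ℕ} (G : SimpleGraph X) (GD : SimpleGraph (Fin k)) (f j : Fin k)
    (P Q : Finset X) : SimpleGraph (X ⊕ Fin k) where
  Adj x y := match x, y with
    | Sum.inl a, Sum.inl b => G.Adj a b
    | Sum.inr a, Sum.inr b => GD.Adj a b
    | Sum.inl a, Sum.inr d => (d = f ∧ ∃ s ∈ P, G.Adj a s) ∨ (d = j ∧ ∃ s ∈ Q, G.Adj a s)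
    | Sum.inr d, Sum.inl a => (d = f ∧ ∃ s ∈ P, G.Adj a s) ∨ (d = j ∧ ∃ s ∈ Q, G.Adj a s)
  symm := ⟨by
    rintro (a | a) (b | b) h
    · exact SimpleGraph.Adj.symm (G := G) h
    · exact h
    · exact h
    · exact SimpleGraph.Adj.symm (G := GD) h⟩
  loopless := ⟨by
    rintro (a | a) h
    · exact G.loopless.irrefl _ h
    · exact GD.loopless.irrefl _ h⟩

lemma att_le {X : Type*} {k : ℕ} (G : SimpleGraph X) (GD : SimpleGraph (Fin k)) (f j : Fin k)
    (P Q K : Finset X) (D : Finset (Fin k)) :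
    (∑ a ∈ K, ∑ d ∈ D, if (glueG G GD f j P Q).Adj (Sum.inl a) (Sum.inr d) then (1:ℤ) else 0)
      ≤ (if f ∈ D then eb G K P else 0) + (if j ∈ D then eb G K Q else 0) := by
  have key : ∀ a ∈ K, (∑ d ∈ D, if (glueG G GD f j P Q).Adj (Sum.inl a) (Sum.inr d) then (1:ℤ) else 0)
      ≤ (if f ∈ D then ∑ s ∈ P, (if G.Adj a s then (1:ℤ) else 0) else 0)
       + (if j ∈ D then ∑ s ∈ Q, (if G.Adj a s then (1:ℤ) else 0) else 0) := by
    intro a _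
    have h0 : ∀ T : Finset X, 0 ≤ ∑ s ∈ T, (if G.Adj a s then (1:ℤ) else 0) := fun T =>
      Finset.sum_nonneg fun b _ => by split_ifs <;> norm_num
    have h1 : ∀ T : Finset X, (∃ s ∈ T, G.Adj a s) → 1 ≤ ∑ s ∈ T, (if G.Adj a s then (1:ℤ) else 0) := by
      rintro T ⟨s, hs, ha⟩
      have := Finset.single_le_sum (f := fun s => if G.Adj a s then (1:ℤ) else 0)
        (fun b _ => by split_ifs <;> norm_num) hs
      simpa only [if_pos ha] using this
    have h2 : ∀ d ∈ D, (if (glueG G GD f j P Q).Adj (Sum.inl a) (Sum.inr d) then (1:ℤ) else 0) ≤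
        (if d = f then ∑ s ∈ P, (if G.Adj a s then (1:ℤ) else 0) else 0)
        + (if d = j then ∑ s ∈ Q, (if G.Adj a s then (1:ℤ) else 0) else 0) := by
      intro d _
      have p0 := h0 P
      have q0 := h0 Q
      split_ifs with c1 c2 c3 c3 c2 c3 c3
      all_goals try linarith
      all_goals
        rcases c1 with ⟨e, c1⟩ | ⟨e, c1⟩
        all_goals first
          | (exact absurd e (by assumption))
          | (have := h1 _ c1; linarith)
    refine (Finset.sum_le_sum h2).trans ?_
    rw [Finset.sum_add_distrib, Finset.sum_ite_eq', Finset.sum_ite_eq']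
  refine (Finset.sum_le_sum key).trans (le_of_eq ?_)
  rw [Finset.sum_add_distrib]
  unfold eb
  split_ifs <;> simp only [Finset.sum_const_zero]

lemma eb_glue {X : Type*} {k : ℕ} (G : SimpleGraph X) (GD : SimpleGraph (Fin k)) (f j : Fin k)
    (P Q K : Finset X) (D : Finset (Fin k)) :
    eb (glueG G GD f j P Q) (K.disjSum D) (K.disjSum D) ≤ eb G K K + eb GD D D +
      2 * ((if f ∈ D then eb G K P else 0) + (if j ∈ D then eb G K Q else 0)) := by
  have h := att_le G GD f j P Q K D
  have h2 : eb (glueG G GD f j P Q) (K.disjSum D) (K.disjSum D) = eb G K K + eb GD D D +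
      2 * (∑ a ∈ K, ∑ d ∈ D, if (glueG G GD f j P Q).Adj (Sum.inl a) (Sum.inr d) then (1:ℤ) else 0) := by
    have e1 : (∑ d ∈ D, ∑ a ∈ K, if (glueG G GD f j P Q).Adj (Sum.inr d) (Sum.inl a) then (1:ℤ) else 0)
      = (∑ a ∈ K, ∑ d ∈ D, if (glueG G GD f j P Q).Adj (Sum.inl a) (Sum.inr d) then (1:ℤ) else 0) := by
      rw [Finset.sum_comm]
      rfl
    unfold eb
    rw [Finset.sum_disjSum]
    simp only [Finset.sum_disjSum]
    rw [Finset.sum_add_distrib, Finset.sum_add_distrib, e1]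
    change _ + _ + (_ + _) = _
    have e2 : (∑ a ∈ K, ∑ b ∈ K, if (glueG G GD f j P Q).Adj (Sum.inl a) (Sum.inl b) then (1:ℤ) else 0)
      = ∑ a ∈ K, ∑ b ∈ K, if G.Adj a b then (1:ℤ) else 0 := rfl
    have e3 : (∑ a ∈ D, ∑ b ∈ D, if (glueG G GD f j P Q).Adj (Sum.inr a) (Sum.inr b) then (1:ℤ) else 0)
      = ∑ a ∈ D, ∑ b ∈ D, if GD.Adj a b then (1:ℤ) else 0 := rfl
    rw [e2, e3]
    ring
  linarith

lemma pot_glue {X : Type*} {k : ℕ} (G : SimpleGraph X) (GD : SimpleGraph (Fin k)) (f j : Fin k)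
    (w : X → ℤ) (wD : Fin k → ℤ)
    (P Q K : Finset X) (D : Finset (Fin k)) :
    pot G w K + pot GD wD D - 4 * ((if f ∈ D then eb G K P else 0) + (if j ∈ D then eb G K Q else 0))
      ≤ pot (glueG G GD f j P Q) (Sum.elim w wD) (K.disjSum D) := by
  have := eb_glue G GD f j P Q K D
  unfold pot
  rw [Finset.sum_disjSum]
  simp only [Sum.elim_inl, Sum.elim_inr]
  linarith

lemma glue {X : Type*} [Fintype X] {G : SimpleGraph X} {w : X → ℤ} (hm : MinC G w)
    {S W AS : Finset X} (hSW : S ⊆ W) (hA : Good G w S AS)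
    (huniq : ∀ a, a ∉ S → ∀ s ∈ S, ∀ t ∈ S, G.Adj a s → G.Adj a t → s = t)
    {k : ℕ} (GD : SimpleGraph (Fin k)) (wD : Fin k → ℤ) (f j : Fin k)
    (wf : wD f = 4) (wj : wD j = 1) (hwD : ∀ d, wD d = 1 ∨ wD d = 4 ∨ wD d = 5) (c : ℤ)
    (hD : ∀ D0, (if f ∈ D0 then c else 0) + (if j ∈ D0 then 1 else 0) ≤ pot GD wD D0)
    (hDpos : ∀ D0 : Finset (Fin k), D0.Nonempty → 0 < pot GD wD D0)
    (h3 : ∀ AD : Finset (Fin k), (∀ d, wD d = 1 → d ∈ AD) → f ∉ AD → Forest' GD (Finset.univ \ AD) →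
      ∃ d ∈ AD, GD.Adj f d)
    (h4 : ∀ K ⊆ W \ S, K.Nonempty → 0 < pot G w K + c - 4 * eb G K (S \ AS) ∧
      0 < pot G w K + 1 - 4 * eb G K AS ∧
      0 < pot G w K + c + 1 - 4 * (eb G K (S \ AS) + eb G K AS))
    (hsize : 2 * (k : ℤ) + eb GD Finset.univ Finset.univ < 2 * S.card + eb G S S) :
    ∃ A, Good G w W A ∧ ∀ s ∈ S, (s ∈ A ↔ s ∈ AS) := by
  set H := glueG G GD f j (S \ AS) AS with hH
  obtain ⟨ψ, hψ⟩ := hm.small.apply H (Sum.elim w wD) ((W \ S).disjSum Finset.univ)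
    (by
      rintro (a | d) _
      · exact hm.cases a
      · exact hwD d)
    (by
      intro K hK hne
      rw [← Finset.toLeft_disjSum_toRight (u := K)]
      have hp := pot_glue G GD f j w wD (S \ AS) AS K.toLeft K.toRight
      rw [← hH] at hp
      refine lt_of_lt_of_le ?_ hp
      have hK0 : K.toLeft ⊆ W \ S := by
        intro a ha
        have := hK (Finset.mem_toLeft.1 ha)
        simpa using this
      have hDD := hD K.toRight
      rcases K.toLeft.eq_empty_or_nonempty with he | hne'
      · rw [he]
        simp only [eb_empty_left]
        have : K.toRight.Nonempty := by
          obtain ⟨a | d, hx⟩ := hne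
          · have := Finset.mem_toLeft.2 hx
            rw [he] at this
            simp at this
          · exact ⟨d, Finset.mem_toRight.2 hx⟩
        have := hDpos _ this
        have e : pot G w ∅ = 0 := by simp [pot, eb_empty_left]
        rw [e]
        split_ifs <;> linarith
      · have hp := hm.pos _ hne'
        obtain ⟨q1, q2, q3⟩ := h4 _ hK0 hne'
        split_ifs at hDD ⊢ <;> linarith)
    (by
      have h1 := eb_glue G GD f j (S \ AS) AS (W \ S) Finset.univ
      rw [← hH] at h1
      simp only [Finset.mem_univ, if_true] at h1
      rw [← eb_union_right G (Finset.sdiff_disjoint), Finset.sdiff_union_of_subset hA.sub] at h1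
      have h2 : eb G W W = eb G (W \ S) (W \ S) + eb G S S + 2 * eb G (W \ S) S := by
        conv_lhs => rw [← Finset.sdiff_union_of_subset hSW]
        rw [eb_union_left G Finset.sdiff_disjoint, eb_union_right G Finset.sdiff_disjoint,
          eb_union_right G Finset.sdiff_disjoint, eb_comm G S (W \ S)]
        ring
      have h5 := eb_mono G (Finset.subset_univ W) (Finset.subset_univ W)
      have h6 : (W \ S).card + S.card = W.card := Finset.card_sdiff_add_card_eq_card hSW
      have h7 := Finset.card_le_univ W
      rw [Finset.card_disjSum, Finset.card_univ, Fintype.card_fin]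
      push_cast
      zify at h6 h7
      linarith)
  -- basic facts on ψ
  have hj : Sum.inr j ∈ ψ := hψ.one _ (by simp) (by simpa using wj)
  have hf : Sum.inr f ∉ ψ := hψ.four _ (by simp) (by simpa using wf)
  have hfd : ∃ d, Sum.inr d ∈ ψ ∧ GD.Adj f d := by
    obtain ⟨d, hd, h⟩ := h3 ψ.toRight
      (fun d hd => Finset.mem_toRight.2 (hψ.one _ (by simp) (by simpa using hd)))
      (by simpa using hf) (by
        intro C hC hne
        obtain ⟨c, hc, hl⟩ := hψ.forest (C.map Function.Embedding.inr) (by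
          intro x hx
          obtain ⟨d, hd, rfl⟩ := Finset.mem_map.1 hx
          have := hC hd
          simpa using this) (hne.map)
        obtain ⟨d, hd, rfl⟩ := Finset.mem_map.1 hc
        refine ⟨d, hd, fun a ha b hb h1 h2 => ?_⟩
        have := hl (Sum.inr a) (Finset.mem_map.2 ⟨a, ha, rfl⟩) (Sum.inr b)
          (Finset.mem_map.2 ⟨b, hb, rfl⟩) h1 h2
        exact Sum.inr_injective this)
    exact ⟨d, Finset.mem_toRight.1 hd, h⟩
  -- outside neighbours of S are not in ψ
  have hin : ∀ a s, s ∈ S → s ∈ AS → G.Adj a s → H.Adj (Sum.inl a) (Sum.inr j) :=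
    fun a s _ hs h => Or.inr ⟨rfl, s, hs, h⟩
  have hinf : ∀ a s, s ∈ S → s ∉ AS → G.Adj a s → H.Adj (Sum.inl a) (Sum.inr f) :=
    fun a s hS hs h => Or.inl ⟨rfl, s, Finset.mem_sdiff.2 ⟨hS, hs⟩, h⟩
  have hout : ∀ a s, s ∈ S → G.Adj a s → Sum.inl a ∉ ψ := by
    intro a s hs h ha
    by_cases hsA : s ∈ AS
    · exact (hψ.ind _ ha _ hj (by simp)).1 (hin a s hs hsA h)
    · obtain ⟨d, hd, hfd⟩ := hfd
      exact (hψ.ind _ ha _ hd (by simp)).2 (Sum.inr f) (by simp) ⟨hinf a s hs hsA h, hfd⟩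
  have hψW : ∀ a, Sum.inl a ∈ ψ → a ∈ W ∧ a ∉ S := by
    intro a ha
    have := hψ.sub ha
    simpa using this
  set A := AS ∪ ψ.toLeft with hAdef
  have memA : ∀ a, a ∈ A ↔ a ∈ AS ∨ Sum.inl a ∈ ψ := by
    intro a; simp [hAdef]
  have hS : ∀ s ∈ S, (s ∈ A ↔ s ∈ AS) := by
    intro s hs
    rw [memA]
    exact ⟨fun h => h.resolve_right fun h => (hψW s h).2 hs, Or.inl⟩
  have hnS : ∀ s, s ∉ S → (s ∈ A ↔ Sum.inl s ∈ ψ) := by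
    intro s hs
    rw [memA]
    exact ⟨fun h => h.resolve_left fun h => hs (hA.sub h), Or.inr⟩
  have inW : ∀ a, a ∈ W → a ∉ S → (Sum.inl a : X ⊕ Fin k) ∈ (W \ S).disjSum Finset.univ := by
    intro a h1 h2; simp [h1, h2]
  refine ⟨A, ⟨?_, ?_, ?_, ?_, ?_⟩, hS⟩
  · intro a ha
    rcases (memA a).1 ha with h | h
    · exact hSW (hA.sub h)
    · exact (hψW a h).1
  · intro a ha hwa
    by_cases haS : a ∈ S
    · exact (hS a haS).2 (hA.one a haS hwa)
    · exact (hnS a haS).2 (hψ.one _ (inW a ha haS) (by simpa using hwa))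
  · intro a ha hwa
    by_cases haS : a ∈ S
    · rw [hS a haS]; exact hA.four a haS hwa
    · rw [hnS a haS]; exact hψ.four _ (inW a ha haS) (by simpa using hwa)
  · -- mixed case
    have mixed : ∀ a ∈ AS, ∀ b, Sum.inl b ∈ ψ → ¬ G.Adj a b ∧ ∀ m ∈ W, ¬ (G.Adj a m ∧ G.Adj m b) := by
      intro a ha b hb
      refine ⟨fun h => hout b a (hA.sub ha) h.symm hb, ?_⟩
      rintro m hm ⟨h1, h2⟩
      by_cases hmS : m ∈ S
      · exact hout b m hmS h2.symm hb
      · have := hin m a (hA.sub ha) ha h1.symm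
        exact (hψ.ind _ hb _ hj (by simp)).2 (Sum.inl m) (inW m hm hmS) ⟨h2.symm, this⟩
    intro a ha b hb hab
    rcases (memA a).1 ha with h | h <;> rcases (memA b).1 hb with h' | h'
    · obtain ⟨g1, g2⟩ := hA.ind a h b h' hab
      refine ⟨g1, ?_⟩
      rintro m hm ⟨e1, e2⟩
      by_cases hmS : m ∈ S
      · exact g2 m hmS ⟨e1, e2⟩
      · exact hab (huniq m hmS a (hA.sub h) b (hA.sub h') e1.symm e2)
    · exact mixed a h b h'
    · obtain ⟨g1, g2⟩ := mixed b h' a h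
      exact ⟨fun h => g1 h.symm, fun m hm ⟨e1, e2⟩ => g2 m hm ⟨e2.symm, e1.symm⟩⟩
    · obtain ⟨g1, g2⟩ := hψ.ind _ h _ h' (by simpa using hab)
      refine ⟨g1, ?_⟩
      rintro m hm ⟨e1, e2⟩
      by_cases hmS : m ∈ S
      · exact hout a m hmS e1 h
      · exact g2 (Sum.inl m) (inW m hm hmS) ⟨e1, e2⟩
  · intro C hC hne
    have hCW : ∀ a ∈ C, a ∈ W ∧ a ∉ A := fun a ha => Finset.mem_sdiff.1 (hC ha)
    by_cases hCS : C ⊆ S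
    · refine hA.forest C (fun a ha => Finset.mem_sdiff.2 ⟨hCS ha, ?_⟩) hne
      rw [← hS a (hCS ha)]
      exact (hCW a ha).2
    · obtain ⟨a₀, ha₀, ha₀S⟩ := Finset.not_subset.1 hCS
      let C' : Finset (X ⊕ Fin k) := (C \ S).disjSum {f}
      have hC' : C' ⊆ ((W \ S).disjSum Finset.univ) \ ψ := by
        rintro (a | d) hx
        · have hx' : a ∈ C ∧ a ∉ S := by simpa [C'] using hx
          refine Finset.mem_sdiff.2 ⟨inW a (hCW a hx'.1).1 hx'.2, ?_⟩
          rw [← hnS a hx'.2]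
          exact (hCW a hx'.1).2
        · have hx' : d = f := by simpa [C'] using hx
          subst hx'
          exact Finset.mem_sdiff.2 ⟨by simp, hf⟩
      obtain ⟨x, hx, hxf, hl⟩ := hψ.forest.strong _ C' rfl
        (by convert hC') (Sum.inr f) (by simp [C'])
        ⟨Sum.inl a₀, by simp [C', ha₀, ha₀S], by simp⟩
      rcases x with a | d
      · have hx' : a ∈ C ∧ a ∉ S := by simpa [C'] using hx
        have hcf : ∀ y ∈ C, y ∈ S → G.Adj a y → H.Adj (Sum.inl a) (Sum.inr f) := by
          intro y hy hyS hay
          exact hinf a y hyS (by rw [← hS y hyS]; exact (hCW y hy).2) hay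
        have hcC : ∀ y ∈ C, y ∉ S → Sum.inl y ∈ C' := fun y h1 h2 => by simp [C', h1, h2]
        have hfC : Sum.inr f ∈ C' := by simp [C']
        refine ⟨a, hx'.1, fun y hy z hz h1 h2 => ?_⟩
        by_cases hyS : y ∈ S <;> by_cases hzS : z ∈ S
        · exact huniq a hx'.2 y hyS z hzS h1 h2
        · have := hl _ hfC _ (hcC z hz hzS) (hcf y hy hyS h1) h2
          simp at this
        · have := hl _ hfC _ (hcC y hy hyS) (hcf z hz hzS h2) h1
          simp at this
        · exact Sum.inl_injective (hl _ (hcC y hy hyS) _ (hcC z hz hzS) h1 h2)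
      · have hx' : d = f := by simpa [C'] using hx
        exact absurd (by rw [hx']) hxf

/-- gadget with an edge `f i` and an isolated vertex `j` -/
def G3 : SimpleGraph (Fin 3) where
  Adj a b := (a = 0 ∧ b = 1) ∨ (a = 1 ∧ b = 0)
  symm := ⟨by intro a b h; tauto⟩
  loopless := ⟨by intro a h; omega⟩

def w3 : Fin 3 → ℤ := ![4, 1, 1]

/-- gadget with a triangle on 0, 1, 2 and an isolated vertex `j` -/
def G4 : SimpleGraph (Fin 4) where
  Adj a b := a ≠ b ∧ a ≠ 3 ∧ b ≠ 3
  symm := ⟨by intro a b h; tauto⟩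
  loopless := ⟨by intro a h; tauto⟩

def w4 : Fin 4 → ℤ := ![4, 5, 5, 1]

lemma pot_indicator {X : Type*} [Fintype X] (G : SimpleGraph X) (w : X → ℤ) (D : Finset X) :
    pot G w D = ∑ a, (if a ∈ D then w a - 2 * ∑ b, (if b ∈ D then (if G.Adj a b then 1 else 0) else 0)
      else 0) := by
  unfold pot eb
  rw [Finset.mul_sum, ← Finset.sum_sub_distrib]
  simp only [Finset.sum_ite_mem, Finset.univ_inter]

lemma pot3 (D : Finset (Fin 3)) : pot G3 w3 D = (if 0 ∈ D then 4 else 0) + (if 1 ∈ D then 1 else 0)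
    + (if 2 ∈ D then 1 else 0) - (if 0 ∈ D ∧ 1 ∈ D then 4 else 0) := by
  rw [pot_indicator]
  simp only [Fin.sum_univ_three, w3, G3]
  by_cases h0 : 0 ∈ D <;> by_cases h1 : 1 ∈ D <;> by_cases h2 : 2 ∈ D <;> simp [h0, h1, h2]

lemma pot4 (D : Finset (Fin 4)) : pot G4 w4 D = (if 0 ∈ D then 4 else 0) + (if 1 ∈ D then 5 else 0)
    + (if 2 ∈ D then 5 else 0) + (if 3 ∈ D then 1 else 0) - (if 0 ∈ D ∧ 1 ∈ D then 4 else 0)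
    - (if 0 ∈ D ∧ 2 ∈ D then 4 else 0) - (if 1 ∈ D ∧ 2 ∈ D then 4 else 0) := by
  rw [pot_indicator]
  simp only [Fin.sum_univ_four, w4, G4]
  by_cases h0 : 0 ∈ D <;> by_cases h1 : 1 ∈ D <;> by_cases h2 : 2 ∈ D <;> by_cases h3 : 3 ∈ D <;>
    simp [h0, h1, h2, h3]

lemma eb3 : eb G3 Finset.univ Finset.univ = 2 := by
  unfold eb
  simp only [Fin.sum_univ_three, G3]
  simp

lemma eb4 : eb G4 Finset.univ Finset.univ = 6 := by
  unfold eb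
  simp only [Fin.sum_univ_four, G4]
  simp

lemma glue3 {X : Type*} [Fintype X] {G : SimpleGraph X} {w : X → ℤ} (hm : MinC G w)
    {S W AS : Finset X} (hSW : S ⊆ W) (hA : Good G w S AS)
    (huniq : ∀ a, a ∉ S → ∀ s ∈ S, ∀ t ∈ S, G.Adj a s → G.Adj a t → s = t)
    (h4 : ∀ K ⊆ W \ S, K.Nonempty → 0 < pot G w K + 1 - 4 * eb G K (S \ AS) ∧
      0 < pot G w K + 1 - 4 * eb G K AS ∧
      0 < pot G w K + 1 + 1 - 4 * (eb G K (S \ AS) + eb G K AS))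
    (hsize : 8 < 2 * (S.card : ℤ) + eb G S S) :
    ∃ A, Good G w W A ∧ ∀ s ∈ S, (s ∈ A ↔ s ∈ AS) := by
  refine glue hm hSW hA huniq G3 w3 0 2 (by simp [w3]) (by simp [w3]) ?_ 1 ?_ ?_ ?_ h4 ?_
  · intro d; fin_cases d <;> simp [w3]
  · intro D
    rw [pot3]
    by_cases h0 : 0 ∈ D <;> by_cases h1 : 1 ∈ D <;> by_cases h2 : 2 ∈ D <;> simp [h0, h1, h2]
  · rintro D ⟨x, hx⟩
    rw [pot3]
    by_cases h0 : 0 ∈ D <;> by_cases h1 : 1 ∈ D <;> by_cases h2 : 2 ∈ D <;> simp [h0, h1, h2]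
    fin_cases x <;> simp_all
  · intro AD h1 _ _
    exact ⟨1, h1 1 (by simp [w3]), by simp [G3]⟩
  · rw [eb3]; push_cast; linarith

lemma glue4 {X : Type*} [Fintype X] {G : SimpleGraph X} {w : X → ℤ} (hm : MinC G w)
    {S W AS : Finset X} (hSW : S ⊆ W) (hA : Good G w S AS)
    (huniq : ∀ a, a ∉ S → ∀ s ∈ S, ∀ t ∈ S, G.Adj a s → G.Adj a t → s = t)
    (h4 : ∀ K ⊆ W \ S, K.Nonempty → 0 < pot G w K + 2 - 4 * eb G K (S \ AS) ∧
      0 < pot G w K + 1 - 4 * eb G K AS ∧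
      0 < pot G w K + 2 + 1 - 4 * (eb G K (S \ AS) + eb G K AS))
    (hsize : 14 < 2 * (S.card : ℤ) + eb G S S) :
    ∃ A, Good G w W A ∧ ∀ s ∈ S, (s ∈ A ↔ s ∈ AS) := by
  refine glue hm hSW hA huniq G4 w4 0 3 (by simp [w4]) (by simp [w4]) ?_ 2 ?_ ?_ ?_ h4 ?_
  · intro d; fin_cases d <;> simp [w4]
  · intro D
    rw [pot4]
    by_cases h0 : 0 ∈ D <;> by_cases h1 : 1 ∈ D <;> by_cases h2 : 2 ∈ D <;> by_cases h3 : 3 ∈ D <;>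
      simp [h0, h1, h2, h3]
  · rintro D ⟨x, hx⟩
    rw [pot4]
    by_cases h0 : 0 ∈ D <;> by_cases h1 : 1 ∈ D <;> by_cases h2 : 2 ∈ D <;> by_cases h3 : 3 ∈ D <;>
      simp [h0, h1, h2, h3]
    fin_cases x <;> simp_all
  · intro AD _ a0 hfor
    by_contra hcon
    push Not at hcon
    have a1 : (1 : Fin 4) ∉ AD := fun h => hcon 1 h (by simp [G4])
    have a2 : (2 : Fin 4) ∉ AD := fun h => hcon 2 h (by simp [G4])
    obtain ⟨c, hc, hl⟩ := hfor {0, 1, 2} (by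
      intro d hd
      simp only [Finset.mem_insert, Finset.mem_singleton] at hd
      rcases hd with rfl | rfl | rfl <;> simp [*]) (by simp)
    simp only [Finset.mem_insert, Finset.mem_singleton] at hc
    rcases hc with rfl | rfl | rfl
    · have := hl 1 (by simp) 2 (by simp) (by simp [G4]) (by simp [G4])
      simp at this
    · have := hl 0 (by simp) 2 (by simp) (by simp [G4]) (by simp [G4])
      simp at this
    · have := hl 0 (by simp) 1 (by simp) (by simp [G4]) (by simp [G4])
      simp at this
  · rw [eb4]; push_cast; linarith

lemma MinC.uniq {X : Type*} [Fintype X] {G : SimpleGraph X} {w : X → ℤ} (hm : MinC G w)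
    {S : Finset X} (hS : pot G w S ≤ 2) :
    ∀ a, a ∉ S → ∀ s ∈ S, ∀ t ∈ S, G.Adj a s → G.Adj a t → s = t := by
  intro a ha s hs t ht h1 h2
  by_contra hne
  have h3 := eb_pos_two G hs ht hne h1 h2
  have h4 := hm.pos (insert a S) (Finset.insert_nonempty _ _)
  rw [pot_insert G w ha] at h4
  have h5 : w a ≤ 5 := by rcases hm.cases a with h | h | h <;> omega
  linarith

lemma MinC.colour {X : Type*} [Fintype X] {G : SimpleGraph X} {w : X → ℤ} (hm : MinC G w)
    (w' : X → ℤ) (hw' : ∀ a, w' a = 1 ∨ w' a = 4 ∨ w' a = 5)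
    {S : Finset X} (hS : S ≠ Finset.univ) (hpos : ∀ K ⊆ S, K.Nonempty → 0 < pot G w' K) :
    ∃ A, Good G w' S A := by
  refine hm.small.apply G w' S (fun a _ => hw' a) hpos ?_
  have h1 : S.card < Fintype.card X := by
    rw [← Finset.card_univ]
    exact Finset.card_lt_card (Finset.ssubset_univ_iff.2 hS)
  have h2 := eb_mono G (Finset.subset_univ S) (Finset.subset_univ S)
  zify at h1
  linarith

lemma pot_split {X : Type*} (G : SimpleGraph X) (w : X → ℤ) {K S AS : Finset X}
    (hd : Disjoint K S) (hA : AS ⊆ S) :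
    pot G w (K ∪ S) = pot G w K + pot G w S - 4 * (eb G K (S \ AS) + eb G K AS) := by
  rw [pot_union G w hd, ← eb_union_right G Finset.sdiff_disjoint, Finset.sdiff_union_of_subset hA]

lemma sum_ge {X : Type*} (w : X → ℤ) (hw : ∀ a, w a = 1 ∨ w a = 4 ∨ w a = 5)
    (S T : Finset X) (hT : T ⊆ S) : (S.card : ℤ) + ∑ a ∈ T, (w a - 1) ≤ ∑ a ∈ S, w a := by
  have h1 : ∑ a ∈ T, (w a - 1) ≤ ∑ a ∈ S, (w a - 1) :=
    Finset.sum_le_sum_of_subset_of_nonneg hT fun a _ _ => by rcases hw a with h | h | h <;> omega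
  rw [Finset.sum_sub_distrib (s := S)] at h1
  simp only [Finset.sum_const, nsmul_eq_mul, mul_one] at h1
  linarith

lemma MinC.gap {X : Type*} [Fintype X] {G : SimpleGraph X} {w : X → ℤ} (hm : MinC G w)
    {S : Finset X} (hS : S ≠ Finset.univ) {x : X} (hx : x ∈ S) (hwx : w x = 5) :
    2 ≤ pot G w S := by
  by_contra hcon
  have hp := hm.pos S ⟨x, hx⟩
  have h1 : pot G w S = 1 := by omega
  obtain ⟨AS, hAS⟩ := hm.colour w hm.cases hS (fun K _ => hm.pos K)
  have hsz : 8 < 2 * (S.card : ℤ) + eb G S S := by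
    have h2 := sum_ge w hm.cases S {x} (by simpa using hx)
    rw [Finset.sum_singleton, hwx] at h2
    have h3 : 2 * eb G S S = ∑ a ∈ S, w a - 1 := by unfold pot at h1; linarith
    have h4 := eb_le_card G S
    have h5 : 0 < S.card := Finset.card_pos.2 ⟨x, hx⟩
    rcases Nat.lt_or_ge S.card 3 with h | h
    · exfalso
      interval_cases hc : S.card
      · norm_num at h4 h2; linarith
      · norm_num at h4 h2; linarith
    · zify at h
      linarith
  obtain ⟨A, hA, _⟩ := glue3 hm (Finset.subset_univ S) hAS (hm.uniq (by omega)) (by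
    intro K hK hne
    have hd : Disjoint K S := by
      rw [Finset.disjoint_left]
      intro a ha
      exact (Finset.mem_sdiff.1 (hK ha)).2
    have h2 := hm.pos (K ∪ S) (hne.mono Finset.subset_union_left)
    rw [pot_split G w hd hAS.sub, h1] at h2
    have e1 := eb_nonneg G K (S \ AS)
    have e2 := eb_nonneg G K AS
    refine ⟨?_, ?_, ?_⟩ <;> linarith) hsz
  exact hm.no ⟨A, hA⟩

lemma ext_lemma {X : Type*} [Fintype X] {G : SimpleGraph X} {w : X → ℤ} {u1 u2 v w0 : X}
    (h12 : u1 ≠ u2) (n1 : ∀ y, G.Adj u1 y ↔ y = v ∨ y = u2) (n2 : ∀ y, G.Adj u2 y ↔ y = u1 ∨ y = w0)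
    (hw1 : w u1 = 5) (hw2 : w u2 = 5) (hv1 : v ≠ u1) (hv2 : v ≠ u2) (h01 : w0 ≠ u1) (h02 : w0 ≠ u2)
    {R A : Finset X} (hR : ∀ a, a ∈ R ↔ a ≠ u1 ∧ a ≠ u2)
    (hA : Good G w R A) (h : v ∈ A ∨ w0 ∈ A ∨ ∀ y, G.Adj v y → y ∉ A) :
    ∃ A', Good G w Finset.univ A' := by
  have hA1 : u1 ∉ A := fun h => ((hR _).1 (hA.sub h)).1 rfl
  have hA2 : u2 ∉ A := fun h => ((hR _).1 (hA.sub h)).2 rfl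
  have hind : ∀ a ∈ A, ∀ b ∈ A, a ≠ b → ¬ G.Adj a b ∧ ∀ m, ¬ (G.Adj a m ∧ G.Adj m b) := by
    intro a ha b hb hab
    obtain ⟨g1, g2⟩ := hA.ind a ha b hb hab
    refine ⟨g1, ?_⟩
    rintro m ⟨e1, e2⟩
    by_cases hm1 : m = u1
    · subst hm1
      have f1 := (n1 _).1 e1.symm
      have f2 := (n1 _).1 e2
      grind
    by_cases hm2 : m = u2
    · subst hm2
      have f1 := (n2 _).1 e1.symm
      have f2 := (n2 _).1 e2
      grind
    exact g2 m ((hR m).2 ⟨hm1, hm2⟩) ⟨e1, e2⟩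
  have hone : ∀ a, w a = 1 → a ∈ A := by
    intro a ha
    refine hA.one a ((hR a).2 ⟨?_, ?_⟩) ha
    · rintro rfl; omega
    · rintro rfl; omega
  have hfour : ∀ a, w a = 4 → a ∉ A := by
    intro a ha
    refine hA.four a ((hR a).2 ⟨?_, ?_⟩) ha
    · rintro rfl; omega
    · rintro rfl; omega
  have hfor : ∀ C : Finset X, (∀ a ∈ C, a ∉ A) → C.Nonempty → u1 ∉ C → u2 ∉ C →
      ∃ c ∈ C, ∀ a ∈ C, ∀ b ∈ C, G.Adj c a → G.Adj c b → a = b := by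
    intro C hC hne c1 c2
    refine hA.forest C (fun a ha => Finset.mem_sdiff.2 ⟨(hR a).2 ⟨?_, ?_⟩, hC a ha⟩) hne
    · rintro rfl; exact c1 ha
    · rintro rfl; exact c2 ha
  by_cases hcase : v ∈ A ∨ w0 ∈ A
  · refine ⟨A, Finset.subset_univ _, fun a _ => hone a, fun a _ => hfour a,
      fun a ha b hb hab => ⟨(hind a ha b hb hab).1, fun m _ => (hind a ha b hb hab).2 m⟩, ?_⟩
    intro C hC hne
    have hCA : ∀ a ∈ C, a ∉ A := fun a ha => (Finset.mem_sdiff.1 (hC ha)).2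
    by_cases c1 : u1 ∈ C
    · by_cases hvA : v ∈ A
      · refine ⟨u1, c1, fun a ha b hb e1 e2 => ?_⟩
        have f1 := (n1 _).1 e1
        have f2 := (n1 _).1 e2
        grind
      · have hwA := hcase.resolve_left hvA
        by_cases c2 : u2 ∈ C
        · refine ⟨u2, c2, fun a ha b hb e1 e2 => ?_⟩
          have f1 := (n2 _).1 e1
          have f2 := (n2 _).1 e2
          grind
        · refine ⟨u1, c1, fun a ha b hb e1 e2 => ?_⟩
          have f1 := (n1 _).1 e1
          have f2 := (n1 _).1 e2
          grind
    · by_cases c2 : u2 ∈ C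
      · refine ⟨u2, c2, fun a ha b hb e1 e2 => ?_⟩
        have f1 := (n2 _).1 e1
        have f2 := (n2 _).1 e2
        grind
      · exact hfor C hCA hne c1 c2
  · push Not at hcase
    have hnb : ∀ y, G.Adj v y → y ∉ A := by
      rcases h with h | h | h
      · exact absurd h hcase.1
      · exact absurd h hcase.2
      · exact h
    have hu : ∀ b ∈ A, ¬ G.Adj u1 b ∧ ∀ m, ¬ (G.Adj u1 m ∧ G.Adj m b) := by
      intro b hb
      refine ⟨fun h => ?_, ?_⟩
      · have := (n1 _).1 h
        grind
      · rintro m ⟨e1, e2⟩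
        rcases (n1 _).1 e1 with rfl | rfl
        · exact hnb b e2 hb
        · have := (n2 _).1 e2
          grind
    refine ⟨insert u1 A, Finset.subset_univ _, fun a _ ha => Finset.mem_insert_of_mem (hone a ha), ?_, ?_, ?_⟩
    · intro a _ ha hmem
      rcases Finset.mem_insert.1 hmem with rfl | h
      · omega
      · exact hfour a ha h
    · intro a ha b hb hab
      rcases Finset.mem_insert.1 ha with e | ha' <;> rcases Finset.mem_insert.1 hb with e' | hb'
      · exact absurd (e.trans e'.symm) hab
      · subst e
        exact ⟨(hu b hb').1, fun m _ => (hu b hb').2 m⟩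
      · subst e'
        exact ⟨fun h => (hu a ha').1 h.symm, fun m _ ⟨e1, e2⟩ => (hu a ha').2 m ⟨e2.symm, e1.symm⟩⟩
      · exact ⟨(hind a ha' b hb' hab).1, fun m _ => (hind a ha' b hb' hab).2 m⟩
    · intro C hC hne
      have hCA : ∀ a ∈ C, a ≠ u1 ∧ a ∉ A := fun a ha => by
        have := (Finset.mem_sdiff.1 (hC ha)).2
        simpa using this
      have c1 : u1 ∉ C := fun h => (hCA _ h).1 rfl
      by_cases c2 : u2 ∈ C
      · refine ⟨u2, c2, fun a ha b hb e1 e2 => ?_⟩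
        have f1 := (n2 _).1 e1
        have f2 := (n2 _).1 e2
        grind
      · exact hfor C (fun a ha => (hCA a ha).2) hne c1 c2

lemma pot_update {X : Type*} (G : SimpleGraph X) (w : X → ℤ) (x : X) (c : ℤ) (K : Finset X) :
    pot G (Function.update w x c) K = pot G w K + if x ∈ K then c - w x else 0 := by
  unfold pot
  by_cases hx : x ∈ K
  · rw [Finset.sum_update_of_mem hx, if_pos hx, ← Finset.add_sum_erase K w hx,
      Finset.sdiff_singleton_eq_erase]
    ring
  · rw [Finset.sum_update_of_notMem hx, if_neg hx]
    ring

lemma closed_case {X : Type*} [Fintype X] {G : SimpleGraph X} {w : X → ℤ} (hm : MinC G w)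
    {u1 u2 v x : X}
    (h12 : u1 ≠ u2) (n1 : ∀ y, G.Adj u1 y ↔ y = v ∨ y = u2) (n2 : ∀ y, G.Adj u2 y ↔ y = u1 ∨ y = v)
    (hw1 : w u1 = 5) (hw2 : w u2 = 5) (hv1 : v ≠ u1) (hv2 : v ≠ u2)
    (nv : ∀ y, G.Adj v y → y = u1 ∨ y = u2 ∨ y = x) (hx1 : x ≠ u1) (hx2 : x ≠ u2)
    (hwx : w x ≠ 1) : False := by
  let R : Finset X := Finset.univ \ {u1, u2}
  have hR : ∀ a, a ∈ R ↔ a ≠ u1 ∧ a ≠ u2 := by intro a; simp [R]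
  have hne : ∀ K ⊆ R, K ≠ Finset.univ := by
    intro K hK h
    have : u1 ∈ K := by rw [h]; simp
    exact ((hR _).1 (hK this)).1 rfl
  obtain ⟨A, hA⟩ := hm.colour (S := R) (Function.update w x 4) (by
      intro a
      by_cases h : a = x
      · subst h; simp
      · simpa [Function.update_of_ne h] using hm.cases a) (hne R (Finset.Subset.refl _)) (by
      intro K hK hKne
      rw [pot_update]
      have hp := hm.pos K hKne
      split_ifs with hxK
      · rcases hm.cases x with h | h | h
        · exact absurd h hwx
        · omega
        · have := hm.gap (hne K hK) hxK h
          omega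
      · omega)
  have hxA : x ∉ A := hA.four x ((hR x).2 ⟨hx1, hx2⟩) (by simp)
  have hA' : Good G w R A := hA.mono (by
      intro a _ ha
      have : a ≠ x := by rintro rfl; exact hwx ha
      simpa [Function.update_of_ne this] using ha) (by
      intro a _ ha
      by_cases h : a = x
      · subst h; simp
      · simpa [Function.update_of_ne h] using ha)
  refine hm.no (ext_lemma h12 n1 n2 hw1 hw2 hv1 hv2 hv1 hv2 hR hA' (Or.inr (Or.inr ?_)))
  intro y hy hyA
  rcases nv y hy with rfl | rfl | rfl
  · exact ((hR _).1 (hA.sub hyA)).1 rfl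
  · exact ((hR _).1 (hA.sub hyA)).2 rfl
  · exact hxA hyA

lemma disj_of_sub {X : Type*} {K W S : Finset X} (hK : K ⊆ W \ S) : Disjoint K S := by
  rw [Finset.disjoint_left]
  intro a ha
  exact (Finset.mem_sdiff.1 (hK ha)).2

lemma tri_out {X : Type*} [Fintype X] {G : SimpleGraph X} {w : X → ℤ} (hm : MinC G w)
    {u1 v x y y1 : X} {S : Finset X} (hS : S = {v, x, y}) (hvx : v ≠ x) (hvy : v ≠ y) (hxy : x ≠ y)
    (hp : pot G w S = 2) (hcard : S.card = 3) (heb : eb G S S = 6)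
    (wv : w v = 4) (wx : w x = 5) (wy : w y = 5)
    (hu1 : u1 ∉ S) (hvu : G.Adj u1 v) (hy1 : y1 ∉ S) (hyy : G.Adj y1 y) : False := by
  have hgood : Good G w S {y} := by
    refine ⟨by simp [hS], ?_, ?_, ?_, ?_⟩
    · intro a ha h
      rw [hS] at ha
      simp only [Finset.mem_insert, Finset.mem_singleton] at ha
      rcases ha with rfl | rfl | rfl <;> omega
    · intro a ha h hay
      rw [Finset.mem_singleton] at hay
      subst hay
      omega
    · intro a ha b hb hab
      rw [Finset.mem_singleton] at ha hb
      exact absurd (ha.trans hb.symm) hab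
    · intro C hC ⟨c, hc⟩
      have hC' : ∀ a ∈ C, a = v ∨ a = x := by
        intro a ha
        have := hC ha
        rw [hS] at this
        simp only [Finset.mem_sdiff, Finset.mem_insert, Finset.mem_singleton] at this
        tauto
      refine ⟨c, hc, fun a ha b hb e1 e2 => ?_⟩
      have := hC' c hc
      have := hC' a ha
      have := hC' b hb
      have := e1.ne
      have := e2.ne
      grind
  have hvS : v ∈ S := by simp [hS]
  have hxS : x ∈ S := by simp [hS]
  have hyS : y ∈ S := by simp [hS]
  obtain ⟨A, hA, _⟩ := glue3 hm (Finset.subset_univ S) hgood (hm.uniq (by omega)) (by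
    intro K hK hne
    have hd := disj_of_sub hK
    have h2 := hm.pos (K ∪ S) (hne.mono Finset.subset_union_left)
    have h3 : ∀ z, z ∉ S → z ∉ K → 2 ≤ pot G w (K ∪ S) := by
      intro z h1 h2
      refine hm.gap ?_ (Finset.mem_union_right _ hxS) wx
      intro h
      have : z ∈ K ∪ S := by rw [h]; simp
      rcases Finset.mem_union.1 this with h | h
      · exact h2 h
      · exact h1 h
    rw [pot_split G w hd hgood.sub, hp] at h2 h3
    have e1 := eb_nonneg G K (S \ {y})
    have e2 := eb_nonneg G K {y}
    refine ⟨?_, ?_, ?_⟩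
    · by_cases hK1 : y1 ∈ K
      · have := eb_pos G (L := {y}) hK1 (by simp) hyy
        linarith
      · have := h3 y1 hy1 hK1
        linarith
    · by_cases hK1 : u1 ∈ K
      · have := eb_pos G (L := S \ {y}) hK1 (by simp [hvS, hvy]) hvu
        linarith
      · have := h3 u1 hu1 hK1
        linarith
    · linarith) (by rw [hcard, heb]; norm_num)
  exact hm.no ⟨A, hA⟩

lemma tri_in {X : Type*} [Fintype X] {G : SimpleGraph X} {w : X → ℤ} (hm : MinC G w)
    {u1 u2 v w0 x y : X}
    (h12 : u1 ≠ u2) (n1 : ∀ y, G.Adj u1 y ↔ y = v ∨ y = u2) (n2 : ∀ y, G.Adj u2 y ↔ y = u1 ∨ y = w0)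
    (nv : ∀ z, G.Adj v z ↔ z = u1 ∨ z = x ∨ z = y)
    (nx : ∀ z, G.Adj x z → z = v ∨ z = y) (ny : ∀ z, G.Adj y z → z = v ∨ z = x)
    (hw1 : w u1 = 5) (hw2 : w u2 = 5) (wv : w v = 4) (wx : w x = 5) (wy : w y = 5)
    (hvx : v ≠ x) (hvy : v ≠ y) (hxy : x ≠ y) (hy1 : y ≠ u1) : False := by
  let R : Finset X := Finset.univ \ {u1, u2, v, x, y}
  have hR : ∀ a, a ∈ R ↔ a ≠ u1 ∧ a ≠ u2 ∧ a ≠ v ∧ a ≠ x ∧ a ≠ y := by intro a; simp [R]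
  have hne : R ≠ Finset.univ := by
    intro h
    have : u1 ∈ R := by rw [h]; simp
    exact ((hR _).1 this).1 rfl
  obtain ⟨A, hA⟩ := hm.colour w hm.cases hne (fun K _ => hm.pos K)
  have hAR : ∀ a ∈ A, a ≠ u1 ∧ a ≠ u2 ∧ a ≠ v ∧ a ≠ x ∧ a ≠ y := fun a ha => (hR a).1 (hA.sub ha)
  have hyb : ∀ b ∈ A, ¬ G.Adj y b ∧ ∀ m, ¬ (G.Adj y m ∧ G.Adj m b) := by
    intro b hb
    have hb' := hAR b hb
    refine ⟨fun h => ?_, ?_⟩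
    · have := ny b h
      grind
    · rintro m ⟨e1, e2⟩
      rcases ny m e1 with rfl | rfl
      · have := (nv b).1 e2
        grind
      · have := nx b e2
        grind
  have hind : ∀ a ∈ A, ∀ b ∈ A, a ≠ b → ¬ G.Adj a b ∧ ∀ m, ¬ (G.Adj a m ∧ G.Adj m b) := by
    intro a ha b hb hab
    obtain ⟨g1, g2⟩ := hA.ind a ha b hb hab
    have ha' := hAR a ha
    have hb' := hAR b hb
    refine ⟨g1, ?_⟩
    rintro m ⟨e1, e2⟩
    by_cases hm1 : m = u1
    · subst hm1
      have := (n1 _).1 e2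
      grind
    by_cases hm2 : m = u2
    · subst hm2
      have := (n2 _).1 e2
      have := (n2 _).1 e1.symm
      grind
    by_cases hm3 : m = v
    · subst hm3
      have := (nv _).1 e2
      grind
    by_cases hm4 : m = x
    · subst hm4
      have := nx _ e2
      grind
    by_cases hm5 : m = y
    · subst hm5
      have := ny _ e2
      grind
    exact g2 m ((hR m).2 ⟨hm1, hm2, hm3, hm4, hm5⟩) ⟨e1, e2⟩
  refine hm.no ⟨insert y A, Finset.subset_univ _, ?_, ?_, ?_, ?_⟩
  · intro a _ ha
    refine Finset.mem_insert_of_mem (hA.one a ((hR a).2 ⟨?_, ?_, ?_, ?_, ?_⟩) ha) <;>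
      (rintro rfl; omega)
  · intro a _ ha hmem
    rcases Finset.mem_insert.1 hmem with rfl | h
    · omega
    · exact hA.four a (hA.sub h) ha h
  · intro a ha b hb hab
    rcases Finset.mem_insert.1 ha with e | ha' <;> rcases Finset.mem_insert.1 hb with e' | hb'
    · exact absurd (e.trans e'.symm) hab
    · subst e
      exact ⟨(hyb b hb').1, fun m _ => (hyb b hb').2 m⟩
    · subst e'
      exact ⟨fun h => (hyb a ha').1 h.symm, fun m _ ⟨e1, e2⟩ => (hyb a ha').2 m ⟨e2.symm, e1.symm⟩⟩
    · exact ⟨(hind a ha' b hb' hab).1, fun m _ => (hind a ha' b hb' hab).2 m⟩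
  · intro C hC hne
    have hCA : ∀ a ∈ C, a ≠ y ∧ a ∉ A := fun a ha => by
      have := (Finset.mem_sdiff.1 (hC ha)).2
      simpa using this
    have cy : y ∉ C := fun h => (hCA _ h).1 rfl
    by_cases cx : x ∈ C
    · refine ⟨x, cx, fun a ha b hb e1 e2 => ?_⟩
      have := nx _ e1
      have := nx _ e2
      grind
    by_cases cv : v ∈ C
    · refine ⟨v, cv, fun a ha b hb e1 e2 => ?_⟩
      have := (nv _).1 e1
      have := (nv _).1 e2
      grind
    by_cases c1 : u1 ∈ C
    · refine ⟨u1, c1, fun a ha b hb e1 e2 => ?_⟩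
      have := (n1 _).1 e1
      have := (n1 _).1 e2
      grind
    by_cases c2 : u2 ∈ C
    · refine ⟨u2, c2, fun a ha b hb e1 e2 => ?_⟩
      have := (n2 _).1 e1
      have := (n2 _).1 e2
      grind
    refine hA.forest C (fun a ha => Finset.mem_sdiff.2 ⟨(hR a).2 ⟨?_, ?_, ?_, ?_, ?_⟩, (hCA a ha).2⟩) hne <;>
      (rintro rfl; contradiction)

lemma open_case {X : Type*} [Fintype X] {G : SimpleGraph X} {w : X → ℤ} (hm : MinC G w)
    {u1 u2 v w0 x y : X}
    (h12 : u1 ≠ u2) (n1 : ∀ y, G.Adj u1 y ↔ y = v ∨ y = u2) (n2 : ∀ y, G.Adj u2 y ↔ y = u1 ∨ y = w0)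
    (nv : ∀ z, G.Adj v z ↔ z = u1 ∨ z = x ∨ z = y)
    (hw1 : w u1 = 5) (hw2 : w u2 = 5) (hv1 : v ≠ u1) (hv2 : v ≠ u2) (h01 : w0 ≠ u1) (h02 : w0 ≠ u2)
    (hxy : x ≠ y) (hx1 : x ≠ u1) (hy1 : y ≠ u1) (hx2 : x ≠ u2) (hy2 : y ≠ u2)
    (hwx : w x ≠ 1) (hwy : w y ≠ 1) (hwv : w v ≠ 1) : False := by
  have avx : G.Adj v x := (nv x).2 (by simp)
  have avy : G.Adj v y := (nv y).2 (by simp)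
  have a1v : G.Adj u1 v := (n1 v).2 (by simp)
  have a12 : G.Adj u1 u2 := (n1 u2).2 (by simp)
  have a20 : G.Adj u2 w0 := (n2 w0).2 (by simp)
  have hvx := avx.ne
  have hvy := avy.ne
  let R : Finset X := Finset.univ \ {u1, u2}
  have hR : ∀ a, a ∈ R ↔ a ≠ u1 ∧ a ≠ u2 := by intro a; simp [R]
  have hneu : ∀ K : Finset X, u1 ∉ K → K ≠ Finset.univ := by
    intro K hK h
    exact hK (by rw [h]; simp)
  have hu1R : u1 ∉ R := fun h => ((hR _).1 h).1 rfl
  let w' := Function.update (Function.update w x 4) y 4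
  have wqx : w' x = 4 := by simp [w', Function.update_of_ne hxy]
  have wqy : w' y = 4 := by simp [w']
  have wqo : ∀ a, a ≠ x → a ≠ y → w' a = w a := by
    intro a h1 h2
    simp [w', Function.update_of_ne h1, Function.update_of_ne h2]
  have hpw : ∀ K, pot G w' K = pot G w K + (if x ∈ K then 4 - w x else 0)
      + (if y ∈ K then 4 - w y else 0) := by
    intro K
    simp only [w']
    rw [pot_update, pot_update, Function.update_of_ne hxy.symm]
  by_cases hall : ∀ K ⊆ R, K.Nonempty → 0 < pot G w' K
  · obtain ⟨A, hA⟩ := hm.colour (S := R) w' (by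
      intro a
      by_cases h1 : a = x
      · subst h1; simp [wqx]
      by_cases h2 : a = y
      · subst h2; simp [wqy]
      rw [wqo a h1 h2]; exact hm.cases a) (hneu R hu1R) hall
    have hA' : Good G w R A := hA.mono (by
        intro a _ ha
        rw [wqo a (by rintro rfl; exact hwx ha) (by rintro rfl; exact hwy ha)]
        exact ha) (by
        intro a _ ha
        by_cases h1 : a = x
        · subst h1; exact wqx
        by_cases h2 : a = y
        · subst h2; exact wqy
        rw [wqo a h1 h2]; exact ha)
    refine hm.no (ext_lemma h12 n1 n2 hw1 hw2 hv1 hv2 h01 h02 hR hA' (Or.inr (Or.inr ?_)))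
    intro z hz hzA
    rcases (nv z).1 hz with rfl | rfl | rfl
    · exact hu1R (hA.sub hzA)
    · exact hA.four _ (hA.sub hzA) wqx hzA
    · exact hA.four _ (hA.sub hzA) wqy hzA
  push Not at hall
  obtain ⟨S, hSR, hSne, hSp⟩ := hall
  have hu1S : u1 ∉ S := fun h => hu1R (hSR h)
  have hu2S : u2 ∉ S := fun h => ((hR _).1 (hSR h)).2 rfl
  have hSu := hneu S hu1S
  have hpos := hm.pos S hSne
  rw [hpw] at hSp
  have wx' : w x = 4 ∨ w x = 5 := (hm.cases x).resolve_left hwx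
  have wy' : w y = 4 ∨ w y = 5 := (hm.cases y).resolve_left hwy
  have wv' : w v = 4 ∨ w v = 5 := (hm.cases v).resolve_left hwv
  have key : x ∈ S ∧ y ∈ S ∧ w x = 5 ∧ w y = 5 ∧ pot G w S = 2 := by
    have gx : x ∈ S → w x = 5 → 2 ≤ pot G w S := fun h h' => hm.gap hSu h h'
    have gy : y ∈ S → w y = 5 → 2 ≤ pot G w S := fun h h' => hm.gap hSu h h'
    by_cases hx : x ∈ S <;> by_cases hy : y ∈ S <;> simp only [hx, hy, if_true, if_false] at hSp gx gy ⊢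
    · rcases wx' with h | h <;> rcases wy' with h' | h' <;> simp only [h, h'] at hSp gx gy ⊢ <;> norm_num at gx gy ⊢ <;> omega
    · rcases wx' with h | h <;> simp only [h] at hSp gx <;> norm_num at gx ⊢ <;> omega
    · rcases wy' with h | h <;> simp only [h] at hSp gy <;> norm_num at gy ⊢ <;> omega
    · omega
  obtain ⟨hxS, hyS, wx, wy, hp⟩ := key
  have huq := hm.uniq (S := S) (by omega)
  have hvS : v ∈ S := by
    by_contra h
    exact hxy (huq v h x hxS y hyS avx avy)
  have hw0S : w0 ∉ S := by
    intro h
    have h1 := pot_insert G w hu1S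
    have h2 : u2 ∉ insert u1 S := by simp [hu2S, h12.symm]
    have h3 := pot_insert G w h2
    have h4 := eb_pos G (K := {u1}) (L := S) (by simp) hvS a1v
    have h5 := eb_pos_two G (L := insert u1 S) (a := u2) (b := u1) (c := w0) (by simp) (by simp [h])
      h01.symm a12.symm a20
    have h6 := hm.pos (insert u2 (insert u1 S)) (Finset.insert_nonempty _ _)
    rw [hw1] at h1
    rw [hw2] at h3
    linarith
  have hsub : ({v, x, y} : Finset X) ⊆ S := by
    intro a ha
    simp only [Finset.mem_insert, Finset.mem_singleton] at ha
    rcases ha with rfl | rfl | rfl <;> assumption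
  have hc3 : ({v, x, y} : Finset X).card = 3 := by
    rw [Finset.card_eq_three]
    exact ⟨v, x, y, hvx, hvy, hxy, rfl⟩
  have hSc := Finset.card_le_card hsub
  rw [hc3] at hSc
  have h2eb : 2 * eb G S S = ∑ a ∈ S, w a - 2 := by unfold pot at hp; linarith
  rcases Nat.lt_or_ge S.card 4 with hlt | hge
  · -- the triangle case
    have hcard : S.card = 3 := by omega
    have hS : S = {v, x, y} := (Finset.eq_of_subset_of_card_le hsub (by rw [hc3, hcard])).symm
    have hsum : ∑ a ∈ S, w a = w v + (w x + w y) := by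
      rw [hS, Finset.sum_insert (by simp [hvx, hvy]), Finset.sum_pair hxy]
    have h4 := eb_le_card G S
    rw [hcard] at h4
    norm_num at h4
    have wv : w v = 4 := by omega
    have heb : eb G S S = 6 := by omega
    have axy : G.Adj x y := by
      by_contra hn
      have hn' : ¬ G.Adj y x := fun h => hn h.symm
      have : eb G S S = 4 := by
        rw [hS]
        unfold eb
        rw [Finset.sum_insert (by simp [hvx, hvy]), Finset.sum_pair hxy]
        rw [Finset.sum_insert (by simp [hvx, hvy]), Finset.sum_pair hxy]
        rw [Finset.sum_insert (by simp [hvx, hvy]), Finset.sum_pair hxy]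
        rw [Finset.sum_insert (by simp [hvx, hvy]), Finset.sum_pair hxy]
        simp only [SimpleGraph.irrefl, avx, avy, avx.symm, avy.symm, hn, hn', if_true, if_false]
        norm_num
      omega
    by_cases hyo : ∃ y1, y1 ∉ S ∧ G.Adj y1 y
    · obtain ⟨y1, h1, h2⟩ := hyo
      exact tri_out hm hS hvx hvy hxy hp hcard heb wv wx wy hu1S a1v h1 h2
    by_cases hxo : ∃ x1, x1 ∉ S ∧ G.Adj x1 x
    · obtain ⟨x1, h1, h2⟩ := hxo
      exact tri_out hm (S := S) (by rw [hS]; congr 1; exact Finset.pair_comm x y) hvy hvx hxy.symm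
        hp hcard heb wv wy wx hu1S a1v h1 h2
    push Not at hyo hxo
    have memS : ∀ z, z ∈ S → z = v ∨ z = x ∨ z = y := by
      intro z hz; rw [hS] at hz; simpa using hz
    refine tri_in hm h12 n1 n2 nv ?_ ?_ hw1 hw2 wv wx wy hvx hvy hxy hy1
    · intro z hz
      have h1 : z ∈ S := by
        by_contra h
        exact hxo z h hz.symm
      have := memS z h1
      have := hz.ne
      grind
    · intro z hz
      have h1 : z ∈ S := by
        by_contra h
        exact hyo z h hz.symm
      have := memS z h1
      have := hz.ne
      grind
  · have hsz : 14 < 2 * (S.card : ℤ) + eb G S S := by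
      have h1 := sum_ge w hm.cases S {v, x, y} hsub
      rw [Finset.sum_insert (by simp [hvx, hvy]), Finset.sum_pair hxy] at h1
      omega
    obtain ⟨AS, hAS⟩ := hm.colour w hm.cases hSu (fun K _ => hm.pos K)
    have hgap : ∀ K : Finset X, u1 ∉ K → 2 ≤ pot G w (K ∪ S) := by
      intro K hK
      exact hm.gap (hneu _ (by simp [hK, hu1S])) (Finset.mem_union_right _ hxS) wx
    by_cases hvA : v ∈ AS
    · obtain ⟨A, hA, hAA⟩ := glue3 hm hSR hAS huq (by
        intro K hK hne
        have hd := disj_of_sub hK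
        have h3 := hgap K (fun h => hu1R (Finset.mem_sdiff.1 (hK h)).1)
        rw [pot_split G w hd hAS.sub, hp] at h3
        have e1 := eb_nonneg G K (S \ AS)
        have e2 := eb_nonneg G K AS
        refine ⟨?_, ?_, ?_⟩ <;> linarith) (by linarith)
      exact hm.no (ext_lemma h12 n1 n2 hw1 hw2 hv1 hv2 h01 h02 hR hA (Or.inl ((hAA v hvS).2 hvA)))
    · obtain ⟨A, hA, hAA⟩ := glue4 hm (Finset.subset_univ S) hAS huq (by
        intro K hK hne
        have hd := disj_of_sub hK
        have h2 := hm.pos (K ∪ S) (hne.mono Finset.subset_union_left)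
        have h3 := hgap K
        rw [pot_split G w hd hAS.sub, hp] at h2 h3
        have e1 := eb_nonneg G K (S \ AS)
        have e2 := eb_nonneg G K AS
        refine ⟨?_, ?_, ?_⟩
        · linarith
        · by_cases hK1 : u1 ∈ K
          · have := eb_pos G (L := S \ AS) hK1 (by simp [hvS, hvA]) a1v
            linarith
          · have := h3 hK1
            linarith
        · linarith) hsz
      exact hm.no ⟨A, hA⟩

lemma nbr_two {X : Type*} [Fintype X] {G : SimpleGraph X} {a b : X} (hd : deg G a = 2)
    (hab : G.Adj a b) : ∃ c, c ≠ b ∧ ∀ y, G.Adj a y ↔ y = b ∨ y = c := by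
  unfold deg at hd
  rw [Nat.card_coe_set_eq] at hd
  obtain ⟨p, q, hpq, hs⟩ := Set.ncard_eq_two.1 hd
  have hadj : ∀ y, G.Adj a y ↔ y = p ∨ y = q := by
    intro y
    rw [← SimpleGraph.mem_neighborSet, hs]; simp
  rcases (hadj b).1 hab with rfl | rfl
  · exact ⟨q, hpq.symm, hadj⟩
  · exact ⟨p, hpq, fun y => (hadj y).trans or_comm⟩

lemma nbr_three {X : Type*} [Fintype X] {G : SimpleGraph X} {a b : X} (hd : deg G a = 3)
    (hab : G.Adj a b) : ∃ c d, c ≠ b ∧ d ≠ b ∧ c ≠ d ∧ ∀ y, G.Adj a y ↔ y = b ∨ y = c ∨ y = d := by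
  unfold deg at hd
  rw [Nat.card_coe_set_eq] at hd
  obtain ⟨p, q, r, hpq, hpr, hqr, hs⟩ := Set.ncard_eq_three.1 hd
  have hadj : ∀ y, G.Adj a y ↔ y = p ∨ y = q ∨ y = r := by
    intro y
    rw [← SimpleGraph.mem_neighborSet, hs]; simp
  rcases (hadj b).1 hab with rfl | rfl | rfl
  · exact ⟨q, r, hpq.symm, hpr.symm, hqr, hadj⟩
  · exact ⟨p, r, hpq, hqr.symm, hpr, fun y => (hadj y).trans (by tauto)⟩
  · exact ⟨p, q, hpr, hqr, hpq, fun y => (hadj y).trans (by tauto)⟩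

lemma main_core {X : Type*} [Fintype X] {G : SimpleGraph X} {w : X → ℤ} (hm : MinC G w)
    {u1 u2 v : X} (h12 : G.Adj u1 u2) (hd1 : deg G u1 = 2) (hd2 : deg G u2 = 2)
    (hw1 : w u1 = 5) (hw2 : w u2 = 5) (hv : G.Adj u1 v) (hv2 : v ≠ u2)
    (hdv : deg G v = 3) (hwv : w v ≠ 1) (hnv : ∀ z, G.Adj v z → w z ≠ 1) : False := by
  obtain ⟨c, hc, n1'⟩ := nbr_two hd1 h12
  have hcv : v = c := ((n1' v).1 hv).resolve_left hv2
  subst hcv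
  have n1 : ∀ y, G.Adj u1 y ↔ y = v ∨ y = u2 := fun y => (n1' y).trans or_comm
  obtain ⟨w0, h01, n2⟩ := nbr_two hd2 h12.symm
  have h02 : w0 ≠ u2 := ((n2 w0).2 (by simp)).ne.symm
  obtain ⟨x, y, hx1, hy1, hxy, nv⟩ := nbr_three hdv hv.symm
  have hwx := hnv x ((nv x).2 (by simp))
  have hwy := hnv y ((nv y).2 (by simp))
  by_cases hw0 : w0 = v
  · subst hw0
    have h2 : G.Adj w0 u2 := ((n2 w0).2 (by simp)).symm
    rcases (nv u2).1 h2 with h | h | h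
    · exact h12.ne h.symm
    · subst h
      exact closed_case hm h12.ne n1 n2 hw1 hw2 hv.ne.symm hv2 (x := y)
        (fun z hz => (nv z).1 hz) hy1 hxy.symm hwy
    · subst h
      exact closed_case hm h12.ne n1 n2 hw1 hw2 hv.ne.symm hv2 (x := x)
        (fun z hz => by have := (nv z).1 hz; tauto) hx1 hxy hwx
  · have hnadj : ¬ G.Adj v u2 := by
      intro h
      rcases (n2 v).1 h.symm with h | h
      · exact hv.ne h.symm
      · exact hw0 h.symm
    exact open_case hm h12.ne n1 n2 nv hw1 hw2 hv.ne.symm hv2 h01 h02 hxy hx1 hy1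
      (by rintro rfl; exact hnadj ((nv _).2 (by simp)))
      (by rintro rfl; exact hnadj ((nv _).2 (by simp))) hwx hwy hwv

end Helpers

/-- Claim 3.7: in a minimal counterexample, a 3-vertex in `F ∪ U` with no neighbor in `I`
is not incident to a 2-thread. -/
theorem three_vertex_not_incident_two_thread {V : Type*} [Fintype V] (G : SimpleGraph V)
    (I F U : Set V) (hmin : IsMinCounterexample G I F U)
    (v : V) (hv : v ∈ F ∪ U) (hdeg : deg G v = 3)
    (hnoI : ∀ u, G.Adj v u → u ∉ I) :
    ¬ ∃ p : List V, IsThread G I F U p ∧ p.length = 2 ∧ BordersThread G p v := by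
  rintro ⟨p, ⟨_, _, hch, hp, _⟩, hlen, hvp, q, hq, hqv⟩
  have hass := hmin.1.1
  have hm := minC_of_min hmin
  obtain ⟨a, b, rfl⟩ := List.length_eq_two.1 hlen
  have hab : G.Adj a b := by
    have hch2 : List.IsChain G.Adj [a, b] := hch
    simpa using hch2
  have hU : ∀ z, z ∈ U → wt I F z = 5 := by
    intro z hz
    have h1 : z ∉ I := fun h => Set.disjoint_left.1 hass.2.2.1 h hz
    have h2 : z ∉ F := fun h => Set.disjoint_left.1 hass.2.2.2 h hz
    simp [wt, h1, h2]
  have hI : ∀ z, z ∉ I → wt I F z ≠ 1 := by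
    intro z hz
    unfold wt
    rw [if_neg hz]
    split_ifs <;> norm_num
  have hvI : v ∉ I := by
    intro h
    rcases hv with h' | h'
    · exact Set.disjoint_left.1 hass.2.1 h h'
    · exact Set.disjoint_left.1 hass.2.2.1 h h'
  obtain ⟨ha, hda⟩ := hp a (by simp)
  obtain ⟨hb, hdb⟩ := hp b (by simp)
  have hva : v ≠ a := by rintro rfl; simp at hvp
  have hvb : v ≠ b := by rintro rfl; simp at hvp
  simp only [List.mem_cons, List.not_mem_nil, or_false] at hq
  rcases hq with rfl | rfl
  · exact main_core hm hab hda hdb (hU _ ha) (hU _ hb) hqv hvb hdeg (hI v hvI)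
      (fun z hz => hI z (hnoI z hz))
  · exact main_core hm hab.symm hdb hda (hU _ hb) (hU _ ha) hqv hva hdeg (hI v hvI)
      (fun z hz => hI z (hnoI z hz))
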